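/- arXiv:math-ph/0504034 — 3 statements merged into one kernel-verified Lean document; each statement's English description precedes it below -/
import Mathlib

section
/- Schwinger–Dyson (loop) equation from the shift of the second matrix: for every x ∈ ℂ with Im x ≠ 0, one has (1/N)·⟨Tr((x·1−M₁)⁻¹ · V₂′(M₂))⟩ = x·W₁(x) − 1, where V₂′(M₂) denotes the polynomial functional calculus of the derivative V₂′ applied to M₂; i.e. R(x) = x·W₁(x) − 1. -/
open MeasureTheory Matrix

noncomputable section

/-- The space `H_N` of `N×N` complex Hermitian matrices. -/
abbrev HermMat (N : ℕ) : Type := selfAdjoint (Matrix (Fin N) (Fin N) ℂ)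

/-- The Boltzmann weight `exp(-(N/T)·Tr(V₁(M₁)+V₂(M₂)-M₁M₂))`. -/
def hweight (N : ℕ) (T : ℝ) (V₁ V₂ : Polynomial ℝ) (M₁ M₂ : Matrix (Fin N) (Fin N) ℂ) : ℂ :=
  Complex.exp (-((N : ℂ) / (T : ℂ)) *
    (Polynomial.aeval M₁ V₁ + Polynomial.aeval M₂ V₂ - M₁ * M₂).trace)

/-- The normalized expectation value `⟨f⟩`. -/
def expectation (N : ℕ) (T : ℝ) (V₁ V₂ : Polynomial ℝ)
    [MeasurableSpace (HermMat N)] (μ : Measure (HermMat N))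
    (f : Matrix (Fin N) (Fin N) ℂ → Matrix (Fin N) (Fin N) ℂ → ℂ) : ℂ :=
  (∫ p : HermMat N × HermMat N, hweight N T V₁ V₂ p.1.1 p.2.1 ∂(μ.prod μ))⁻¹ *
    ∫ p : HermMat N × HermMat N, f p.1.1 p.2.1 * hweight N T V₁ V₂ p.1.1 p.2.1 ∂(μ.prod μ)

/-- The resolvent `W₁(x) = (1/N)⟨Tr (x·1 - M₁)⁻¹⟩`. -/
def resolvent1 (N : ℕ) (T : ℝ) (V₁ V₂ : Polynomial ℝ)
    [MeasurableSpace (HermMat N)] (μ : Measure (HermMat N)) (x : ℂ) : ℂ :=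
  (1 / (N : ℂ)) * expectation N T V₁ V₂ μ fun M₁ _ =>
    ((x • (1 : Matrix (Fin N) (Fin N) ℂ) - M₁)⁻¹).trace

end

theorem sd_diag {N : ℕ} {A : Matrix (Fin N) (Fin N) ℂ} (hA : A.IsHermitian) :
    ∃ U ∈ Matrix.unitaryGroup (Fin N) ℂ, ∃ l : Fin N → ℝ,
      ∀ p : Polynomial ℝ, Polynomial.aeval A p =
        U * diagonal (fun i => ((p.eval (l i) : ℝ) : ℂ)) * star U := by
  refine ⟨(hA.eigenvectorUnitary : Matrix (Fin N) (Fin N) ℂ), hA.eigenvectorUnitary.2, hA.eigenvalues, fun p => ?_⟩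
  have hs := hA.spectral_theorem
  rw [Unitary.conjStarAlgAut_apply] at hs
  set U : Matrix (Fin N) (Fin N) ℂ := hA.eigenvectorUnitary.val with hU
  have h1 : star U * U = 1 := Unitary.coe_star_mul_self hA.eigenvectorUnitary
  have h2 : U * star U = 1 := Unitary.coe_mul_star_self hA.eigenvectorUnitary
  induction p using Polynomial.induction_on with
  | C a =>
    have : diagonal (fun _ : Fin N => (a : ℂ)) = (a : ℂ) • (1 : Matrix (Fin N) (Fin N) ℂ) := by
      rw [Matrix.smul_one_eq_diagonal]
    simp only [Polynomial.aeval_C, Polynomial.eval_C, this, mul_smul_comm, smul_mul_assoc, mul_one, h2]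
    ext i j
    simp [Algebra.algebraMap_eq_smul_one]
  | add p q hp hq =>
    have : diagonal (fun i => ((Polynomial.eval (hA.eigenvalues i) (p + q) : ℝ) : ℂ)) =
      diagonal (fun i => ((Polynomial.eval (hA.eigenvalues i) p : ℝ) : ℂ)) +
      diagonal (fun i => ((Polynomial.eval (hA.eigenvalues i) q : ℝ) : ℂ)) := by
      rw [diagonal_add]; simp
    rw [this, map_add, hp, hq, mul_add, add_mul]
  | monomial n a h =>
    have : diagonal (fun i => ((Polynomial.eval (hA.eigenvalues i) (Polynomial.C a * Polynomial.X ^ (n+1)) : ℝ) : ℂ)) =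
      diagonal (fun i => ((Polynomial.eval (hA.eigenvalues i) (Polynomial.C a * Polynomial.X ^ n) : ℝ) : ℂ)) *
      diagonal (RCLike.ofReal ∘ hA.eigenvalues) := by
      rw [diagonal_mul_diagonal]; congr 1; ext i; simp [pow_succ, mul_assoc]
    rw [this, pow_succ, ← mul_assoc, map_mul, h, Polynomial.aeval_X]
    refine (congrArg (_ * ·) hs).trans ?_
    simp only [mul_assoc]
    rw [← mul_assoc (star U) U, h1, one_mul]

theorem sd_trPQ {N : ℕ} {A B : Matrix (Fin N) (Fin N) ℂ} (hA : A.IsHermitian)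
    (hB : B.IsHermitian) : ∃ (l m : Fin N → ℝ) (P : Fin N → Fin N → ℝ), (∀ i j, 0 ≤ P i j) ∧
      ∀ p q : Polynomial ℝ, (Polynomial.aeval A p * Polynomial.aeval B q).trace =
        ((∑ i, ∑ j, P i j * (p.eval (l i) * q.eval (m j)) : ℝ) : ℂ) := by
  obtain ⟨U, hU, l, hl⟩ := sd_diag hA
  obtain ⟨V, hV, m, hm⟩ := sd_diag hB
  refine ⟨l, m, fun i j => Complex.normSq ((star U * V) i j), fun i j => Complex.normSq_nonneg _,
    fun p q => ?_⟩
  rw [hl, hm]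
  set D := diagonal (fun i => ((p.eval (l i) : ℝ) : ℂ))
  set F := diagonal (fun i => ((q.eval (m i) : ℝ) : ℂ))
  have : (U * D * star U * (V * F * star V)).trace =
      (D * (star U * V) * F * star (star U * V)).trace := by
    rw [star_mul, star_star]
    rw [show U * D * star U * (V * F * star V) = U * (D * star U * (V * F * star V)) by
      simp only [mul_assoc], trace_mul_comm]
    simp only [mul_assoc]
  rw [this]
  simp only [Matrix.trace, Matrix.diag]
  push_cast
  refine Finset.sum_congr rfl fun i _ => ?_
  rw [Matrix.mul_apply]
  refine Finset.sum_congr rfl fun j _ => ?_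
  simp only [D, F, Matrix.mul_diagonal, Matrix.diagonal_mul, Matrix.star_apply]
  rw [Complex.normSq_eq_conj_mul_self]
  simp only [RCLike.star_def]
  ring

theorem sd_trace_sq {N : ℕ} {A : Matrix (Fin N) (Fin N) ℂ} (hA : A.IsHermitian) :
    (A * A).trace = ((∑ i, ∑ j, ‖A i j‖ ^ 2 : ℝ) : ℂ) := by
  simp only [Matrix.trace, Matrix.diag, Matrix.mul_apply]
  push_cast
  refine Finset.sum_congr rfl fun i _ => Finset.sum_congr rfl fun j _ => ?_
  rw [← hA.apply j i, RCLike.star_def, Complex.mul_conj, Complex.normSq_eq_norm_sq]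
  push_cast
  rfl

theorem sd_lower {N : ℕ} {A B : Matrix (Fin N) (Fin N) ℂ} (hA : A.IsHermitian)
    (hB : B.IsHermitian) (V₁ V₂ : Polynomial ℝ) (c C : ℝ) (h : ∀ x y : ℝ,
      c * (x ^ 2 + y ^ 2) - C ≤ V₁.eval x + V₂.eval y - x * y) :
    ∃ r : ℝ, (Polynomial.aeval A V₁ + Polynomial.aeval B V₂ - A * B).trace = (r : ℂ) ∧
      c * (∑ i, ∑ j, ‖A i j‖ ^ 2 + ∑ i, ∑ j, ‖B i j‖ ^ 2) - N * C ≤ r := by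
  obtain ⟨l, m, P, hP, key⟩ := sd_trPQ hA hB
  have k1 := key V₁ 1
  have k2 := key 1 V₂
  have k3 := key Polynomial.X Polynomial.X
  have k4 := key (Polynomial.X ^ 2) 1
  have k5 := key 1 (Polynomial.X ^ 2)
  have k6 := key 1 1
  simp only [map_one, mul_one, one_mul, Polynomial.aeval_X, Polynomial.eval_one, map_pow,
    Polynomial.eval_X, Polynomial.eval_pow] at k1 k2 k3 k4 k5 k6
  rw [pow_two, sd_trace_sq hA] at k4
  rw [pow_two, sd_trace_sq hB] at k5
  rw [Matrix.trace_one, Fintype.card_fin] at k6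
  have k4' := Complex.ofReal_injective k4
  have k5' := Complex.ofReal_injective k5
  have k6' : (N : ℝ) = ∑ i, ∑ j, P i j := Complex.ofReal_injective (by push_cast; push_cast at k6; exact k6)
  refine ⟨_, by rw [trace_sub, trace_add, k1, k2, k3, ← Complex.ofReal_add, ← Complex.ofReal_sub], ?_⟩
  rw [k4', k5', k6']
  simp only [← Finset.sum_add_distrib, ← Finset.sum_sub_distrib, Finset.mul_sum, Finset.sum_mul]
  refine Finset.sum_le_sum fun i _ => Finset.sum_le_sum fun j _ => ?_
  have := mul_le_mul_of_nonneg_left (h (l i) (m j)) (hP i j)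
  nlinarith [this]

theorem sd_poly_bound {N : ℕ} (p : Polynomial ℝ) : ∃ K : ℝ, 0 ≤ K ∧ ∃ d : ℕ,
    ∀ (M : Matrix (Fin N) (Fin N) ℂ) (t : ℝ), 1 ≤ t → (∀ i j, ‖M i j‖ ≤ t) →
      ∀ i j, ‖Polynomial.aeval M p i j‖ ≤ K * t ^ d := by
  induction p using Polynomial.induction_on with
  | C a =>
    refine ⟨|a|, abs_nonneg _, 0, fun M t ht hM i j => ?_⟩
    simp only [Polynomial.aeval_C, Algebra.algebraMap_eq_smul_one, Matrix.smul_apply,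
      Matrix.one_apply]
    split_ifs <;> simp
  | add p q hp hq =>
    obtain ⟨K, hK, d, h⟩ := hp
    obtain ⟨K', hK', d', h'⟩ := hq
    refine ⟨K + K', by positivity, d + d', fun M t ht hM i j => ?_⟩
    rw [map_add, Matrix.add_apply]
    have e1 : t ^ d ≤ t ^ (d + d') := pow_le_pow_right₀ ht (by omega)
    have e2 : t ^ d' ≤ t ^ (d + d') := pow_le_pow_right₀ ht (by omega)
    calc _ ≤ K * t ^ d + K' * t ^ d' := (norm_add_le _ _).trans (add_le_add (h M t ht hM i j) (h' M t ht hM i j))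
      _ ≤ K * t ^ (d + d') + K' * t ^ (d + d') := by gcongr
      _ = _ := by ring
  | monomial n a h =>
    obtain ⟨K, hK, d, h⟩ := h
    refine ⟨N * K, by positivity, d + 1, fun M t ht hM i j => ?_⟩
    rw [pow_succ, ← mul_assoc, map_mul, Polynomial.aeval_X, Matrix.mul_apply]
    calc _ ≤ ∑ k : Fin N, K * t ^ d * t := by
          refine (norm_sum_le _ _).trans (Finset.sum_le_sum fun k _ => ?_)
          rw [norm_mul]
          exact mul_le_mul (h M t ht hM i k) (hM k j) (norm_nonneg _) (by positivity)
      _ = _ := by simp; ring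

theorem sd_resolvent {N : ℕ} {A : Matrix (Fin N) (Fin N) ℂ} (hA : A.IsHermitian) (x : ℂ)
    (hx : x.im ≠ 0) : IsUnit (x • (1 : Matrix (Fin N) (Fin N) ℂ) - A).det ∧
      ∀ i j, ‖(x • (1 : Matrix (Fin N) (Fin N) ℂ) - A)⁻¹ i j‖ ≤ N * |x.im|⁻¹ := by
  obtain ⟨U, hU, l, hl⟩ := sd_diag hA
  have h1 : star U * U = 1 := (Unitary.mem_iff.1 hU).1
  have h2 : U * star U = 1 := (Unitary.mem_iff.1 hU).2
  have hX := hl Polynomial.X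
  simp only [Polynomial.aeval_X, Polynomial.eval_X] at hX
  have him : ∀ i, (x - l i).im = x.im := by intro i; simp
  have hne : ∀ i, x - l i ≠ 0 := by
    intro i h
    apply hx
    rw [← him i, h]; rfl
  have e1 : x • (1 : Matrix (Fin N) (Fin N) ℂ) - A = U * diagonal (fun i => x - (l i : ℂ)) * star U := by
    have : diagonal (fun i => x - (l i : ℂ)) = x • (1 : Matrix (Fin N) (Fin N) ℂ) - diagonal (fun i => (l i : ℂ)) := by
      rw [Matrix.smul_one_eq_diagonal, diagonal_sub]
    rw [this, mul_sub, sub_mul, ← hX, mul_smul_comm, smul_mul_assoc, mul_one, h2]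
  have e2 : (U * diagonal (fun i => (x - (l i : ℂ))⁻¹) * star U) * (x • (1 : Matrix (Fin N) (Fin N) ℂ) - A) = 1 := by
    rw [e1]
    simp only [mul_assoc]
    rw [← mul_assoc (star U) U, h1, one_mul, ← mul_assoc (diagonal _) (diagonal _), diagonal_mul_diagonal]
    simp only [inv_mul_cancel₀ (hne _), diagonal_one, one_mul, h2]
  refine ⟨(Matrix.isUnit_iff_isUnit_det _).1 (IsUnit.of_mul_eq_one_right _ e2), fun i j => ?_⟩
  rw [Matrix.inv_eq_left_inv e2, Matrix.mul_apply]
  calc _ ≤ ∑ k : Fin N, |x.im|⁻¹ := by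
        refine (norm_sum_le _ _).trans (Finset.sum_le_sum fun k _ => ?_)
        rw [Matrix.mul_diagonal, Matrix.star_apply, norm_mul, norm_mul, norm_star, norm_inv]
        have b1 := entry_norm_bound_of_unitary hU i k
        have b2 := entry_norm_bound_of_unitary hU j k
        have b3 : ‖x - l k‖⁻¹ ≤ |x.im|⁻¹ := by
          apply inv_anti₀ (abs_pos.2 hx)
          rw [← him k]; exact Complex.abs_im_le_norm _
        calc _ ≤ 1 * |x.im|⁻¹ * 1 := by gcongr
          _ = _ := by ring
    _ = _ := by simp

theorem sd_deriv {N : ℕ} (M E : Matrix (Fin N) (Fin N) ℂ) (p : Polynomial ℝ) :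
    ∃ D : Matrix (Fin N) (Fin N) ℂ,
      (∀ i j, HasDerivAt (fun t : ℝ => Polynomial.aeval (M + t • E) p i j) (D i j) 0) ∧
      ∀ B, Commute M B → (D * B).trace = (E * Polynomial.aeval M p.derivative * B).trace := by
  induction p using Polynomial.induction_on with
  | C a =>
    refine ⟨0, fun i j => ?_, fun B _ => by simp⟩
    simp only [Polynomial.aeval_C]
    exact hasDerivAt_const _ _
  | add p q hp hq =>
    obtain ⟨D, h, h2⟩ := hp
    obtain ⟨D', h', h2'⟩ := hq
    refine ⟨D + D', fun i j => ?_, fun B hB => ?_⟩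
    · simp only [map_add, Matrix.add_apply]
      exact (h i j).add (h' i j)
    · simp only [map_add, add_mul, mul_add, trace_add, h2 B hB, h2' B hB]
  | monomial n a h =>
    obtain ⟨D, h, h2⟩ := h
    set q := Polynomial.C a * Polynomial.X ^ n with hq
    have hqq : Polynomial.C a * Polynomial.X ^ (n + 1) = q * Polynomial.X := by
      rw [hq, pow_succ, mul_assoc]
    have hcq : ∀ B, Commute M B → Commute (Polynomial.aeval M q) B := by
      intro B hB
      rw [hq, map_mul, map_pow, Polynomial.aeval_C, Polynomial.aeval_X]
      exact Commute.mul_left (Algebra.commutes _ _) (hB.pow_left n)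
    rw [hqq]
    clear_value q
    have hlin : ∀ i j, HasDerivAt (fun t : ℝ => (M + t • E) i j) (E i j) 0 := by
      intro i j
      simp only [Matrix.add_apply, Matrix.smul_apply]
      simpa using ((hasDerivAt_id (0:ℝ)).smul_const (E i j)).const_add (M i j)
    refine ⟨D * M + Polynomial.aeval M q * E, fun i j => ?_, fun B hB => ?_⟩
    · simp only [map_mul, Polynomial.aeval_X, Matrix.mul_apply, Matrix.add_apply (D * M), ← Finset.sum_add_distrib]
      refine HasDerivAt.fun_sum fun k _ => ?_
      have := HasDerivAt.fun_mul (h i k) (hlin k j)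
      simp only [zero_smul, add_zero] at this
      exact this
    · have hc := hcq B hB
      rw [Polynomial.derivative_mul, Polynomial.derivative_X, mul_one, map_add, map_mul,
        Polynomial.aeval_X, add_mul, trace_add, mul_add, add_mul, trace_add, mul_assoc D,
        h2 (M * B) ((Commute.refl M).mul_right hB)]
      congr 1
      · simp only [mul_assoc]
      · rw [mul_assoc, trace_mul_comm, mul_assoc, mul_assoc, hc.eq]

theorem sd_gauss_bound (a : ℝ) (ha : 0 < a) (n : ℕ) : ∃ K : ℝ, ∀ t : ℝ, 0 ≤ t →
    (1 + t) ^ n * Real.exp (-a * t ^ 2) ≤ K := by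
  refine ⟨n.factorial * Real.exp (1 + 1 / (4 * a)), fun t ht => ?_⟩
  have h1 := Real.pow_div_factorial_le_exp (1 + t) (by linarith) n
  rw [div_le_iff₀ (by positivity)] at h1
  calc _ ≤ Real.exp (1 + t) * n.factorial * Real.exp (-a * t ^ 2) := by gcongr
    _ = n.factorial * Real.exp (1 + t + -a * t ^ 2) := by rw [Real.exp_add (1 + t)]; ring
    _ ≤ _ := by
      refine mul_le_mul_of_nonneg_left (Real.exp_le_exp.2 ?_) (by positivity)
      have : 1 / (4 * a) - t + a * t ^ 2 = a * (t - 1 / (2 * a)) ^ 2 := by field_simp; ring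
      nlinarith [mul_nonneg ha.le (sq_nonneg (t - 1 / (2 * a)))]

section
variable {E : Type*} [NormedAddCommGroup E] [NormedSpace ℝ E] [FiniteDimensional ℝ E]
  [MeasurableSpace E] [BorelSpace E] (μ : Measure E) [μ.IsAddHaarMeasure]

theorem sd_gauss_int (a : ℝ) (ha : 0 < a) (d : ℕ) :
    Integrable (fun y : E => (1 + ‖y‖) ^ d * Real.exp (-a * ‖y‖ ^ 2)) μ := by
  set m := Module.finrank ℝ E + 1 with hm
  obtain ⟨K, hK⟩ := sd_gauss_bound a ha (d + m)
  have hi : Integrable (fun x : E ↦ (1 + ‖x‖) ^ (-(m : ℝ))) μ :=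
    integrable_one_add_norm (by rw [hm]; push_cast; linarith)
  refine (hi.const_mul K).mono' (by fun_prop) (Filter.Eventually.of_forall fun y => ?_)
  have hp : 0 < 1 + ‖y‖ := by positivity
  rw [Real.norm_of_nonneg (by positivity), Real.rpow_neg hp.le, Real.rpow_natCast,
    ← div_eq_mul_inv, le_div_iff₀ (by positivity)]
  have := hK ‖y‖ (norm_nonneg _)
  rw [pow_add] at this
  linarith

theorem sd_lineint (f f' : E → ℂ) (v : E) (hf : Integrable f μ) (hf' : Integrable f' μ)
   (h : ∀ x, HasDerivAt (fun t : ℝ => f (x + t • v)) (f' x) 0) : ∫ x, f' x ∂μ = 0 := by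
  have := integral_bilinear_hasLineDerivAt_right_eq_neg_left_of_integrable (μ := μ)
    (f := f) (f' := f') (g := fun _ => (1:ℂ)) (g' := fun _ => 0) (v := v)
    (B := ContinuousLinearMap.mul ℝ ℂ)
    (by simpa using hf') (by simp) (by simpa using hf) (fun x _ => h x)
      (fun x _ => by simpa [HasLineDerivAt] using hasDerivAt_const (0:ℝ) (1:ℂ))
  simpa using this

theorem sd_weight_cont {X : Type*} [TopologicalSpace X] {N : ℕ} (T : ℝ) (V₁ V₂ : Polynomial ℝ)
    (f g : X → Matrix (Fin N) (Fin N) ℂ) (hf : Continuous f) (hg : Continuous g) :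
    Continuous (fun p => hweight N T V₁ V₂ (f p) (g p)) := by
  unfold hweight
  have h1 : Continuous fun p => Polynomial.aeval (f p) V₁ := (Polynomial.continuous_aeval V₁).comp hf
  have h2 : Continuous fun p => Polynomial.aeval (g p) V₂ := (Polynomial.continuous_aeval V₂).comp hg
  have h3 := ((h1.add h2).sub (hf.mul hg)).matrix_trace
  exact Complex.continuous_exp.comp (continuous_const.mul h3)

theorem sd_weight_bound {N : ℕ} (hN : 1 ≤ N) {T : ℝ} (hT : 0 < T) {V₁ V₂ : Polynomial ℝ}
    (hconf : ∃ c > (0 : ℝ), ∃ C : ℝ, ∀ x y : ℝ,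
      c * (x ^ 2 + y ^ 2) - C ≤ V₁.eval x + V₂.eval y - x * y) :
    ∃ a > (0 : ℝ), ∃ K > (0 : ℝ), ∀ A B : Matrix (Fin N) (Fin N) ℂ, A.IsHermitian → B.IsHermitian →
      ∃ r : ℝ, hweight N T V₁ V₂ A B = (Real.exp r : ℂ) ∧
      ∀ s t : ℝ, s ^ 2 ≤ ∑ i, ∑ j, ‖A i j‖ ^ 2 → t ^ 2 ≤ ∑ i, ∑ j, ‖B i j‖ ^ 2 →
        Real.exp r ≤ K * (Real.exp (-a * s ^ 2) * Real.exp (-a * t ^ 2)) := by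
  obtain ⟨c, hc, C, h⟩ := hconf
  have hN' : (0 : ℝ) < N := by exact_mod_cast hN
  refine ⟨N / T * c, by positivity, Real.exp (N / T * (N * C)), Real.exp_pos _, fun A B hA hB => ?_⟩
  obtain ⟨r, hr, hle⟩ := sd_lower hA hB V₁ V₂ c C h
  refine ⟨-(N / T) * r, ?_, fun s t hs ht => ?_⟩
  · rw [hweight, hr]; push_cast; rfl
  · rw [← Real.exp_add, ← Real.exp_add, Real.exp_le_exp]
    have hNT : 0 < N / T := by positivity
    have h1 : c * (s ^ 2 + t ^ 2) - N * C ≤ r := by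
      refine le_trans ?_ hle
      gcongr
    have := mul_le_mul_of_nonneg_left h1 hNT.le
    linarith

variable {N : ℕ} (ι : E →ₗ[ℝ] Matrix (Fin N) (Fin N) ℂ)

theorem sd_int_slice (hN : 1 ≤ N) {T : ℝ} (hT : 0 < T) {V₁ V₂ : Polynomial ℝ}
    (hconf : ∃ c > (0 : ℝ), ∃ C : ℝ, ∀ x y : ℝ,
      c * (x ^ 2 + y ^ 2) - C ≤ V₁.eval x + V₂.eval y - x * y)
    (hι : ∀ x, (ι x).IsHermitian) (hιc : Continuous ι)
    (hlow : ∀ x, ‖x‖ ^ 2 ≤ ∑ i, ∑ j, ‖ι x i j‖ ^ 2) (x : E) (f : E → ℂ) (hf : Continuous f)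
    (L : ℝ) (d : ℕ) (hb : ∀ y, ‖f y‖ ≤ L * (1 + ‖y‖) ^ d) :
    Integrable (fun y => f y * hweight N T V₁ V₂ (ι x) (ι y)) μ := by
  obtain ⟨a, ha, K, hK, h⟩ := sd_weight_bound hN hT hconf
  refine ((sd_gauss_int μ a ha d).const_mul (L * K * Real.exp (-a * ‖x‖ ^ 2))).mono'
    (hf.mul (sd_weight_cont T V₁ V₂ _ _ continuous_const hιc)).aestronglyMeasurable
    (Filter.Eventually.of_forall fun y => ?_)
  obtain ⟨r, hr, hle⟩ := h _ _ (hι x) (hι y)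
  rw [norm_mul, hr, Complex.norm_real, Real.norm_of_nonneg (Real.exp_pos _).le]
  calc _ ≤ (L * (1 + ‖y‖) ^ d) * (K * (Real.exp (-a * ‖x‖ ^ 2) * Real.exp (-a * ‖y‖ ^ 2))) :=
        mul_le_mul (hb y) (hle _ _ (hlow x) (hlow y)) (Real.exp_pos _).le ((norm_nonneg _).trans (hb y))
    _ = _ := by ring

theorem sd_int_prod (hN : 1 ≤ N) {T : ℝ} (hT : 0 < T) {V₁ V₂ : Polynomial ℝ}
    (hconf : ∃ c > (0 : ℝ), ∃ C : ℝ, ∀ x y : ℝ,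
      c * (x ^ 2 + y ^ 2) - C ≤ V₁.eval x + V₂.eval y - x * y)
    (hι : ∀ x, (ι x).IsHermitian) (hιc : Continuous ι)
    (hlow : ∀ x, ‖x‖ ^ 2 ≤ ∑ i, ∑ j, ‖ι x i j‖ ^ 2) (f : E × E → ℂ) (hf : Continuous f)
    (L : ℝ) (d : ℕ) (hb : ∀ p, ‖f p‖ ≤ L * (1 + ‖p.2‖) ^ d) :
    Integrable (fun p : E × E => f p * hweight N T V₁ V₂ (ι p.1) (ι p.2)) (μ.prod μ) := by
  obtain ⟨a, ha, K, hK, h⟩ := sd_weight_bound hN hT hconf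
  have := (sd_gauss_int μ a ha 0).mul_prod (sd_gauss_int μ a ha d)
  refine (this.const_mul (L * K)).mono'
    (hf.mul (sd_weight_cont T V₁ V₂ _ _ (hιc.comp continuous_fst) (hιc.comp continuous_snd))).aestronglyMeasurable
    (Filter.Eventually.of_forall fun p => ?_)
  obtain ⟨r, hr, hle⟩ := h _ _ (hι p.1) (hι p.2)
  rw [norm_mul, hr, Complex.norm_real, Real.norm_of_nonneg (Real.exp_pos _).le]
  calc _ ≤ (L * (1 + ‖p.2‖) ^ d) * (K * (Real.exp (-a * ‖p.1‖ ^ 2) * Real.exp (-a * ‖p.2‖ ^ 2))) :=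
        mul_le_mul (hb p) (hle _ _ (hlow _) (hlow _)) (Real.exp_pos _).le ((norm_nonneg _).trans (hb p))
    _ = _ := by ring

theorem sd_trace_bound {N : ℕ} (B X : Matrix (Fin N) (Fin N) ℂ) (b s : ℝ)
    (hB : ∀ i j, ‖B i j‖ ≤ b) (hX : ∀ i j, ‖X i j‖ ≤ s) : ‖(B * X).trace‖ ≤ N * (N * (b * s)) := by
  simp only [Matrix.trace, Matrix.diag, Matrix.mul_apply]
  calc _ ≤ ∑ i : Fin N, ∑ j : Fin N, b * s := by
        refine (norm_sum_le _ _).trans (Finset.sum_le_sum fun i _ => ?_)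
        refine (norm_sum_le _ _).trans (Finset.sum_le_sum fun j _ => ?_)
        rw [norm_mul]
        exact mul_le_mul (hB i j) (hX j i) (norm_nonneg _) ((norm_nonneg _).trans (hB i j))
    _ = _ := by simp

theorem sd_slice (hN : 1 ≤ N) {T : ℝ} (hT : 0 < T) {V₁ V₂ : Polynomial ℝ}
    (hconf : ∃ c > (0 : ℝ), ∃ C : ℝ, ∀ x y : ℝ,
      c * (x ^ 2 + y ^ 2) - C ≤ V₁.eval x + V₂.eval y - x * y)
    (hι : ∀ x, (ι x).IsHermitian) (hsurj : ∀ A : Matrix (Fin N) (Fin N) ℂ, A.IsHermitian → ∃ x, ι x = A)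
    (hιc : Continuous ι)
    (hlow : ∀ x, ‖x‖ ^ 2 ≤ ∑ i, ∑ j, ‖ι x i j‖ ^ 2) (hup : ∀ x i j, ‖ι x i j‖ ≤ ‖x‖)
    (x : E) (B : Matrix (Fin N) (Fin N) ℂ) :
    ∫ y, (B * (Polynomial.aeval (ι y) V₂.derivative - ι x)).trace *
      hweight N T V₁ V₂ (ι x) (ι y) ∂μ = 0 := by
  have hB_int : ∀ B : Matrix (Fin N) (Fin N) ℂ, Integrable (fun y =>
      (B * (Polynomial.aeval (ι y) V₂.derivative - ι x)).trace *
      hweight N T V₁ V₂ (ι x) (ι y)) μ := by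
    intro B
    obtain ⟨K, hK, d, hKd⟩ := sd_poly_bound (N := N) V₂.derivative
    obtain ⟨b, hb⟩ : ∃ b, ∀ i j, ‖B i j‖ ≤ b := by
      refine ⟨∑ i, ∑ j, ‖B i j‖, fun i j => ?_⟩
      calc _ ≤ ∑ j, ‖B i j‖ := Finset.single_le_sum (f := fun j => ‖B i j‖) (fun _ _ => norm_nonneg _) (Finset.mem_univ j)
        _ ≤ _ := Finset.single_le_sum (f := fun i => ∑ j, ‖B i j‖) (fun _ _ => by positivity) (Finset.mem_univ i)
    have hc : Continuous fun y => (B * (Polynomial.aeval (ι y) V₂.derivative - ι x)).trace :=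
      (continuous_const.mul (((Polynomial.continuous_aeval _).comp hιc).sub continuous_const)).matrix_trace
    refine sd_int_slice μ ι hN hT hconf hι hιc hlow x _ hc (N * (N * (b * (K + ‖x‖)))) d fun y => ?_
    refine (sd_trace_bound B _ b ((K + ‖x‖) * (1 + ‖y‖) ^ d) hb fun i j => ?_).trans (le_of_eq (by ring))
    rw [Matrix.sub_apply, add_mul]
    refine (norm_sub_le _ _).trans (add_le_add ?_ ?_)
    · exact hKd _ _ (by linarith [norm_nonneg y]) (fun i j => (hup y i j).trans (by linarith)) i j
    · refine (hup x i j).trans (le_mul_of_one_le_right (norm_nonneg _) (one_le_pow₀ (by linarith [norm_nonneg y])))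
  have herm : ∀ B : Matrix (Fin N) (Fin N) ℂ, B.IsHermitian →
     ∫ y, (B * (Polynomial.aeval (ι y) V₂.derivative - ι x)).trace *
      hweight N T V₁ V₂ (ι x) (ι y) ∂μ = 0 := by
    intro B hB
    obtain ⟨v, rfl⟩ := hsurj B hB
    have hw : Integrable (fun y => hweight N T V₁ V₂ (ι x) (ι y)) μ := by
      simpa using sd_int_slice μ ι hN hT hconf hι hιc hlow x (fun _ => 1) continuous_const 1 0 (by simp)
    have := sd_lineint μ (fun y => hweight N T V₁ V₂ (ι x) (ι y))
      (fun y => (-((N : ℂ) / (T : ℂ))) * ((ι v * (Polynomial.aeval (ι y) V₂.derivative - ι x)).trace *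
      hweight N T V₁ V₂ (ι x) (ι y))) v hw ((hB_int _).const_mul _) (fun y => ?_)
    · rw [integral_const_mul] at this
      refine (mul_eq_zero.1 this).resolve_left ?_
      have : (N : ℂ) ≠ 0 := by exact_mod_cast (by omega : N ≠ 0)
      have : (T : ℂ) ≠ 0 := by exact_mod_cast hT.ne'
      simp [*]
    · obtain ⟨D, hD, hDt⟩ := sd_deriv (ι y) (ι v) V₂
      have h1 := hDt 1 (Commute.one_right _)
      rw [mul_one, mul_one] at h1
      obtain ⟨D', hD', hDt'⟩ := sd_deriv (ι y) (ι v) Polynomial.X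
      have d1 : HasDerivAt (fun t : ℝ => (Polynomial.aeval (ι y + t • ι v) V₂).trace) D.trace 0 :=
        HasDerivAt.fun_sum fun i _ => hD i i
      have d2 : HasDerivAt (fun t : ℝ => (ι x * (ι y + t • ι v)).trace) (ι x * ι v).trace 0 := by
        simp only [mul_add, mul_smul_comm, trace_add, trace_smul]
        simpa using ((hasDerivAt_id (0:ℝ)).smul_const (ι x * ι v).trace).const_add (ι x * ι y).trace
      have d3 := (((d1.const_add (Polynomial.aeval (ι x) V₁).trace).fun_sub d2).const_mul (-((N : ℂ) / (T : ℂ)))).cexp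
      simp only [zero_smul, add_zero] at d3
      simp only [hweight, map_add, map_smul, trace_sub, trace_add]
      convert d3 using 1
      rw [h1, mul_sub, trace_sub, trace_mul_comm (ι v) (ι x)]
      ring
  have hdec : B = (realPart B : Matrix (Fin N) (Fin N) ℂ) + Complex.I • (imaginaryPart B : Matrix (Fin N) (Fin N) ℂ) :=
    (realPart_add_I_smul_imaginaryPart B).symm
  have : ∀ y, (B * (Polynomial.aeval (ι y) V₂.derivative - ι x)).trace *
      hweight N T V₁ V₂ (ι x) (ι y) =
      ((realPart B : Matrix (Fin N) (Fin N) ℂ) * (Polynomial.aeval (ι y) V₂.derivative - ι x)).trace *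
      hweight N T V₁ V₂ (ι x) (ι y) + Complex.I * (((imaginaryPart B : Matrix (Fin N) (Fin N) ℂ) * (Polynomial.aeval (ι y) V₂.derivative - ι x)).trace *
      hweight N T V₁ V₂ (ι x) (ι y)) := by
    intro y
    conv_lhs => rw [hdec]
    rw [add_mul, smul_mul_assoc, trace_add, trace_smul, smul_eq_mul]
    ring
  simp only [this]
  rw [integral_add (hB_int _) ((hB_int _).const_mul _), integral_const_mul, herm _ (realPart B).2, herm _ (imaginaryPart B).2]
  simp

theorem sd_abs (hN : 1 ≤ N) {T : ℝ} (hT : 0 < T) {V₁ V₂ : Polynomial ℝ}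
    (hconf : ∃ c > (0 : ℝ), ∃ C : ℝ, ∀ x y : ℝ,
      c * (x ^ 2 + y ^ 2) - C ≤ V₁.eval x + V₂.eval y - x * y)
    (hι : ∀ x, (ι x).IsHermitian) (hsurj : ∀ A : Matrix (Fin N) (Fin N) ℂ, A.IsHermitian → ∃ x, ι x = A)
    (hιc : Continuous ι)
    (hlow : ∀ x, ‖x‖ ^ 2 ≤ ∑ i, ∑ j, ‖ι x i j‖ ^ 2) (hup : ∀ x i j, ‖ι x i j‖ ≤ ‖x‖)
    (x : ℂ) (hx : x.im ≠ 0) :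
    (∫ p : E × E, hweight N T V₁ V₂ (ι p.1) (ι p.2) ∂(μ.prod μ)) ≠ 0 ∧
    (∫ p : E × E, ((x • (1 : Matrix (Fin N) (Fin N) ℂ) - ι p.1)⁻¹ *
            Polynomial.aeval (ι p.2) V₂.derivative).trace * hweight N T V₁ V₂ (ι p.1) (ι p.2) ∂(μ.prod μ))
    = x * (∫ p : E × E, ((x • (1 : Matrix (Fin N) (Fin N) ℂ) - ι p.1)⁻¹).trace *
        hweight N T V₁ V₂ (ι p.1) (ι p.2) ∂(μ.prod μ)) -
      N * ∫ p : E × E, hweight N T V₁ V₂ (ι p.1) (ι p.2) ∂(μ.prod μ) := by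
  have hGc : Continuous fun p : E × E => (x • (1 : Matrix (Fin N) (Fin N) ℂ) - ι p.1)⁻¹ := by
    have h0 : Continuous fun p : E × E => x • (1 : Matrix (Fin N) (Fin N) ℂ) - ι p.1 :=
      continuous_const.sub (hιc.comp continuous_fst)
    simp only [Matrix.inv_def, Ring.inverse_eq_inv']
    exact (h0.matrix_det.inv₀ fun p => (sd_resolvent (hι p.1) x hx).1.ne_zero).smul h0.matrix_adjugate
  have i0 : Integrable (fun p : E × E => hweight N T V₁ V₂ (ι p.1) (ι p.2)) (μ.prod μ) := by
    simpa using sd_int_prod μ ι hN hT hconf hι hιc hlow (fun _ => 1) continuous_const 1 0 (by simp)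
  have i1 : Integrable (fun p : E × E => ((x • (1 : Matrix (Fin N) (Fin N) ℂ) - ι p.1)⁻¹).trace *
        hweight N T V₁ V₂ (ι p.1) (ι p.2)) (μ.prod μ) := by
    refine sd_int_prod μ ι hN hT hconf hι hιc hlow _ hGc.matrix_trace (N * (N * (N * |x.im|⁻¹ * 1))) 0 fun p => ?_
    have := sd_trace_bound _ 1 _ 1 (sd_resolvent (hι p.1) x hx).2
      (fun i j => by rw [Matrix.one_apply]; split_ifs <;> simp)
    simpa using this
  have i2 : Integrable (fun p : E × E => ((x • (1 : Matrix (Fin N) (Fin N) ℂ) - ι p.1)⁻¹ *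
            Polynomial.aeval (ι p.2) V₂.derivative).trace * hweight N T V₁ V₂ (ι p.1) (ι p.2)) (μ.prod μ) := by
    obtain ⟨K, hK, d, hKd⟩ := sd_poly_bound (N := N) V₂.derivative
    refine sd_int_prod μ ι hN hT hconf hι hιc hlow _
      (hGc.mul ((Polynomial.continuous_aeval _).comp (hιc.comp continuous_snd))).matrix_trace
       (N * (N * (N * |x.im|⁻¹ * K))) d fun p => ?_
    refine (sd_trace_bound _ _ _ (K * (1 + ‖p.2‖) ^ d) (sd_resolvent (hι p.1) x hx).2 fun i j => ?_).trans
      (le_of_eq (by ring))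
    exact hKd _ _ (by linarith [norm_nonneg p.2]) (fun i j => (hup p.2 i j).trans (by linarith)) i j
  constructor
  · obtain ⟨a, ha, K, hK, h⟩ := sd_weight_bound hN hT hconf
    choose r hr using fun p : E × E => (h _ _ (hι p.1) (hι p.2)).imp fun r hr => hr.1
    have i0r : Integrable (fun p => Real.exp (r p)) (μ.prod μ) := by
      have := i0.re
      simpa only [hr, RCLike.re_eq_complex_re, Complex.ofReal_re] using this
    simp only [hr]
    rw [integral_complex_ofReal]
    have hpos : 0 < ∫ p, Real.exp (r p) ∂(μ.prod μ) := by
      exact integral_exp_pos i0r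
    exact_mod_cast hpos.ne'
  · have heq : ∀ p : E × E, ((x • (1 : Matrix (Fin N) (Fin N) ℂ) - ι p.1)⁻¹ *
            (Polynomial.aeval (ι p.2) V₂.derivative - ι p.1)).trace *
              hweight N T V₁ V₂ (ι p.1) (ι p.2) =
        ((x • (1 : Matrix (Fin N) (Fin N) ℂ) - ι p.1)⁻¹ *
            Polynomial.aeval (ι p.2) V₂.derivative).trace * hweight N T V₁ V₂ (ι p.1) (ι p.2) -
          x * (((x • (1 : Matrix (Fin N) (Fin N) ℂ) - ι p.1)⁻¹).trace *
            hweight N T V₁ V₂ (ι p.1) (ι p.2)) + N * hweight N T V₁ V₂ (ι p.1) (ι p.2) := by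
      intro p
      have h1 := Matrix.nonsing_inv_mul _ (sd_resolvent (hι p.1) x hx).1
      set G := (x • (1 : Matrix (Fin N) (Fin N) ℂ) - ι p.1)⁻¹
      rw [mul_sub, mul_smul_comm, mul_one] at h1
      have h2 : G * ι p.1 = x • G - 1 := by rw [← h1]; abel
      rw [mul_sub, trace_sub, h2, trace_sub, trace_smul, trace_one, Fintype.card_fin, smul_eq_mul]
      ring
    have i3 : Integrable (fun p : E × E => ((x • (1 : Matrix (Fin N) (Fin N) ℂ) - ι p.1)⁻¹ *
            (Polynomial.aeval (ι p.2) V₂.derivative - ι p.1)).trace *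
              hweight N T V₁ V₂ (ι p.1) (ι p.2)) (μ.prod μ) := by
      simp only [heq]
      exact (i2.sub (i1.const_mul x)).add (i0.const_mul _)
    have hz : ∫ p : E × E, ((x • (1 : Matrix (Fin N) (Fin N) ℂ) - ι p.1)⁻¹ *
            (Polynomial.aeval (ι p.2) V₂.derivative - ι p.1)).trace *
              hweight N T V₁ V₂ (ι p.1) (ι p.2) ∂(μ.prod μ) = 0 := by
      rw [integral_prod _ i3]
      simp only [sd_slice μ ι hN hT hconf hι hsurj hιc hlow hup, integral_zero]
    simp only [heq] at hz
    rw [integral_add (by exact i2.sub (i1.const_mul x)) (i0.const_mul _),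
      integral_sub i2 (i1.const_mul x), integral_const_mul, integral_const_mul] at hz
    linear_combination hz
end

section
attribute [local instance] Matrix.normedAddCommGroup Matrix.normedSpace

theorem sd_conc (N : ℕ) (hN : 1 ≤ N) {T : ℝ} (hT : 0 < T) {V₁ V₂ : Polynomial ℝ}
    (hconf : ∃ c > (0 : ℝ), ∃ C : ℝ, ∀ x y : ℝ,
      c * (x ^ 2 + y ^ 2) - C ≤ V₁.eval x + V₂.eval y - x * y)
    (mE : MeasurableSpace (HermMat N))
    (bE : @BorelSpace (HermMat N) instTopologicalSpaceSubtype mE)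
    (μ : Measure (HermMat N)) (hμ : @Measure.IsAddHaarMeasure (HermMat N) _ instTopologicalSpaceSubtype mE μ)
    (x : ℂ) (hx : x.im ≠ 0) :
    (∫ p : HermMat N × HermMat N, hweight N T V₁ V₂ p.1.1 p.2.1 ∂(μ.prod μ)) ≠ 0 ∧
    (∫ p : HermMat N × HermMat N, ((x • (1 : Matrix (Fin N) (Fin N) ℂ) - p.1.1)⁻¹ *
            Polynomial.aeval (p.2.1) V₂.derivative).trace * hweight N T V₁ V₂ (p.1.1) (p.2.1) ∂(μ.prod μ))
    = x * (∫ p : HermMat N × HermMat N, ((x • (1 : Matrix (Fin N) (Fin N) ℂ) - p.1.1)⁻¹).trace *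
        hweight N T V₁ V₂ (p.1.1) (p.2.1) ∂(μ.prod μ)) -
      N * ∫ p : HermMat N × HermMat N, hweight N T V₁ V₂ (p.1.1) (p.2.1) ∂(μ.prod μ) := by
  have hfd : FiniteDimensional ℝ (HermMat N) := Module.Finite.of_injective
    (selfAdjoint.submodule ℝ (Matrix (Fin N) (Fin N) ℂ)).subtype Subtype.val_injective
  let ι : HermMat N →ₗ[ℝ] Matrix (Fin N) (Fin N) ℂ :=
    (selfAdjoint.submodule ℝ (Matrix (Fin N) (Fin N) ℂ)).subtype
  refine @sd_abs (HermMat N) inferInstance inferInstance hfd mE bE μ hμ N ι hN T hT V₁ V₂ hconf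
    (fun x => x.2) (fun A hA => ⟨⟨A, hA⟩, rfl⟩) continuous_subtype_val ?_ ?_ x hx
  · intro y
    have hnn : 0 ≤ ∑ i, ∑ j, ‖y.1 i j‖ ^ 2 := by positivity
    have : ‖y.1‖ ≤ Real.sqrt (∑ i, ∑ j, ‖y.1 i j‖ ^ 2) := by
      rw [Matrix.norm_le_iff (Real.sqrt_nonneg _)]
      intro i j
      apply Real.le_sqrt_of_sq_le
      calc _ ≤ ∑ j, ‖y.1 i j‖ ^ 2 := Finset.single_le_sum (f := fun j => ‖y.1 i j‖ ^ 2)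
              (fun _ _ => by positivity) (Finset.mem_univ j)
        _ ≤ _ := Finset.single_le_sum (f := fun i => ∑ j, ‖y.1 i j‖ ^ 2)
              (fun _ _ => by positivity) (Finset.mem_univ i)
    exact (Real.le_sqrt (norm_nonneg _) hnn).1 this
  · intro y i j
    exact Matrix.norm_entry_le_entrywise_sup_norm y.1
end

theorem schwinger_dyson_shift
    (N : ℕ) (hN : 1 ≤ N) (T : ℝ) (hT : 0 < T) (V₁ V₂ : Polynomial ℝ)
    (hconf : ∃ c > (0 : ℝ), ∃ C : ℝ, ∀ x y : ℝ,
      c * (x ^ 2 + y ^ 2) - C ≤ V₁.eval x + V₂.eval y - x * y)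
    [MeasurableSpace (HermMat N)] [BorelSpace (HermMat N)]
    (μ : Measure (HermMat N)) [μ.IsAddHaarMeasure] :
    ∀ x : ℂ, x.im ≠ 0 →
      (1 / (N : ℂ)) * expectation N T V₁ V₂ μ (fun M₁ M₂ =>
          (((x • (1 : Matrix (Fin N) (Fin N) ℂ) - M₁)⁻¹ *
            Polynomial.aeval M₂ V₂.derivative)).trace)
        = x * resolvent1 N T V₁ V₂ μ x - 1 := by
  intro x hx
  obtain ⟨hZ, h⟩ := sd_conc N hN hT hconf _ inferInstance μ inferInstance x hx
  have hN' : (N : ℂ) ≠ 0 := by exact_mod_cast (by omega : N ≠ 0)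
  unfold resolvent1 expectation
  rw [h]
  field_simp
end

section
/- Loop equation for the two-matrix model (exact finite-N form): for every x ∈ ℂ with Im x ≠ 0 and every y ∈ ℂ, one has (y − Y(x)) · (T·U(x,y) − V₂′(y) + x) + (T²/N²)·U(x,y;x) = E(x,y). -/
open MeasureTheory Matrix

noncomputable section

/-- `Y(x) = V₁'(x) - T·W₁(x)`. -/
def Yfun (N : ℕ) (T : ℝ) (V₁ V₂ : Polynomial ℝ)
    [MeasurableSpace (HermMat N)] (μ : Measure (HermMat N)) (x : ℂ) : ℂ :=
  Polynomial.aeval x V₁.derivative - (T : ℂ) * resolvent1 N T V₁ V₂ μ x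

/-- The two-variable polynomial `S_V(u,v) = (V'(u)-V'(v))/(u-v)`, evaluated at a scalar `z`
and a matrix `M`. -/
def SVmat (V : Polynomial ℝ) {N : ℕ} (z : ℂ) (M : Matrix (Fin N) (Fin N) ℂ) :
    Matrix (Fin N) (Fin N) ℂ :=
  ∑ k ∈ Finset.range (V.derivative.natDegree + 1),
    (V.derivative.coeff k : ℂ) • ∑ l ∈ Finset.range k, z ^ l • M ^ (k - 1 - l)

/-- `U(x,y) = (1/N)⟨Tr((x·1-M₁)⁻¹ S_{V₂}(y,M₂))⟩`. -/
def Ufun (N : ℕ) (T : ℝ) (V₁ V₂ : Polynomial ℝ)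
    [MeasurableSpace (HermMat N)] (μ : Measure (HermMat N)) (x y : ℂ) : ℂ :=
  (1 / (N : ℂ)) * expectation N T V₁ V₂ μ fun M₁ M₂ =>
    (((x • (1 : Matrix (Fin N) (Fin N) ℂ) - M₁)⁻¹ * SVmat V₂ y M₂)).trace

/-- `P(x,y) = (1/N)⟨Tr(S_{V₁}(x,M₁) S_{V₂}(y,M₂))⟩`. -/
def Pfun (N : ℕ) (T : ℝ) (V₁ V₂ : Polynomial ℝ)
    [MeasurableSpace (HermMat N)] (μ : Measure (HermMat N)) (x y : ℂ) : ℂ :=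
  (1 / (N : ℂ)) * expectation N T V₁ V₂ μ fun M₁ M₂ =>
    ((SVmat V₁ x M₁ * SVmat V₂ y M₂)).trace

/-- The connected correlator `U(x,y;x')`. -/
def Uconn (N : ℕ) (T : ℝ) (V₁ V₂ : Polynomial ℝ)
    [MeasurableSpace (HermMat N)] (μ : Measure (HermMat N)) (x y x' : ℂ) : ℂ :=
  expectation N T V₁ V₂ μ (fun M₁ M₂ =>
      (((x • (1 : Matrix (Fin N) (Fin N) ℂ) - M₁)⁻¹ * SVmat V₂ y M₂)).trace *
        ((x' • (1 : Matrix (Fin N) (Fin N) ℂ) - M₁)⁻¹).trace)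
    - (N : ℂ) ^ 2 * Ufun N T V₁ V₂ μ x y * resolvent1 N T V₁ V₂ μ x'

/-- `E(x,y) = (V₁'(x)-y)(V₂'(y)-x) - T·P(x,y) + T`. -/
def Efun (N : ℕ) (T : ℝ) (V₁ V₂ : Polynomial ℝ)
    [MeasurableSpace (HermMat N)] (μ : Measure (HermMat N)) (x y : ℂ) : ℂ :=
  (Polynomial.aeval x V₁.derivative - y) * (Polynomial.aeval y V₂.derivative - x)
    - (T : ℂ) * Pfun N T V₁ V₂ μ x y + (T : ℂ)

end


noncomputable section LoopEq

open scoped Matrix.Norms.Frobenius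

namespace LoopEq

variable {N : ℕ}

local notation "Mat" => Matrix (Fin N) (Fin N) ℂ

theorem top_eq {N : ℕ} : (instTopologicalSpaceMatrix : TopologicalSpace (Matrix (Fin N) (Fin N) ℂ)) =
    (Matrix.frobeniusNormedAddCommGroup (m := Fin N) (n := Fin N) (α := ℂ)).toPseudoMetricSpace.toUniformSpace.toTopologicalSpace :=
  rfl

/-- Matrices carry the topology of the Frobenius norm (the same as the product topology). -/
local instance topInst {N : ℕ} : TopologicalSpace (Matrix (Fin N) (Fin N) ℂ) :=
  (Matrix.frobeniusNormedAddCommGroup (m := Fin N) (n := Fin N)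
    (α := ℂ)).toPseudoMetricSpace.toUniformSpace.toTopologicalSpace

/-- Matrices carry the uniformity of the Frobenius norm. -/
local instance unifInst {N : ℕ} : UniformSpace (Matrix (Fin N) (Fin N) ℂ) :=
  (Matrix.frobeniusNormedAddCommGroup (m := Fin N) (n := Fin N)
    (α := ℂ)).toPseudoMetricSpace.toUniformSpace

theorem fin_dim {N : ℕ} : FiniteDimensional ℝ (HermMat N) := by
  have : FiniteDimensional ℝ (selfAdjoint.submodule ℝ (Matrix (Fin N) (Fin N) ℂ)) := inferInstance
  exact this

local instance finDimInst {N : ℕ} : FiniteDimensional ℝ (HermMat N) := fin_dim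

local instance properInst {N : ℕ} : ProperSpace (HermMat N) := FiniteDimensional.proper ℝ _


theorem SV_mul (V : Polynomial ℝ) (z : ℂ) (M : Mat) :
    SVmat V z M * (z • 1 - M) =
      (Polynomial.aeval z V.derivative) • (1 : Mat) - Polynomial.aeval M V.derivative := by
  have h : Commute (z • (1 : Mat)) M := (Commute.one_left M).smul_left z
  simp only [Polynomial.aeval_eq_sum_range, SVmat, Finset.sum_mul, Finset.sum_smul,
    ← Finset.sum_sub_distrib]
  refine Finset.sum_congr rfl fun k _ => ?_
  have := h.geom_sum₂_mul k
  simp only [smul_pow, one_pow, smul_mul_assoc, one_mul] at this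
  rw [smul_mul_assoc, Finset.sum_mul]
  simp only [smul_mul_assoc]
  rw [Finset.sum_mul] at this
  simp only [smul_mul_assoc] at this
  rw [this, smul_sub, smul_smul, smul_assoc, ← Complex.coe_smul]
  simp [smul_smul]

theorem frob_sq (X : Mat) : ((‖X‖ ^ 2 : ℝ) : ℂ) = (Xᴴ * X).trace := by
  rw [Matrix.frobenius_norm_def, ← Real.sqrt_eq_rpow, Real.sq_sqrt (by positivity)]
  simp only [Matrix.trace, Matrix.diag, Matrix.mul_apply, Matrix.conjTranspose_apply]
  push_cast
  rw [Finset.sum_comm]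
  refine Finset.sum_congr rfl fun i _ => Finset.sum_congr rfl fun j _ => ?_
  have := Complex.conj_mul' (X j i)
  rw [RCLike.star_def, this]
  norm_cast

theorem res_norm (M : HermMat N) (x : ℂ) (B : Mat) :
    x.im ^ 2 * ‖B‖ ^ 2 ≤ ‖(x • 1 - M.1) * B‖ ^ 2 := by
  have key : ‖(x • 1 - M.1) * B‖ ^ 2 = ‖((x.re : ℂ) • 1 - M.1) * B‖ ^ 2 + x.im ^ 2 * ‖B‖ ^ 2 := by
    have hM : M.1ᴴ = M.1 := M.2
    have h : (((‖(x • 1 - M.1) * B‖ ^ 2 : ℝ)) : ℂ) =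
      (((‖((x.re : ℂ) • 1 - M.1) * B‖ ^ 2 : ℝ) + x.im ^ 2 * (‖B‖ ^ 2 : ℝ) : ℝ) : ℂ) := by
      rw [frob_sq]
      push_cast
      rw [← Complex.ofReal_pow, frob_sq, ← Complex.ofReal_pow ‖B‖, frob_sq,
        ← smul_eq_mul ((x.im : ℂ) ^ 2), ← Matrix.trace_smul, ← Matrix.trace_add]
      congr 1
      simp only [Matrix.conjTranspose_mul, Matrix.conjTranspose_sub, Matrix.conjTranspose_smul, hM,
        Matrix.conjTranspose_one]
      have h2 : (star x • (1 : Mat) - M.1) * (x • 1 - M.1) =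
        (star (x.re : ℂ) • (1 : Mat) - M.1) * ((x.re : ℂ) • 1 - M.1) + ((x.im : ℂ) ^ 2) • 1 := by
        simp only [sub_mul, mul_sub, smul_mul_assoc, mul_smul_comm, one_mul, mul_one]
        have h3 : star x * x = (x.re : ℂ) * x.re + (x.im : ℂ) ^ 2 := by
          apply Complex.ext <;> (simp [sq]; try ring)
        have h4 : star x + x = (x.re : ℂ) + x.re := by
          apply Complex.ext <;> simp
        have h5 : star (x.re : ℂ) = (x.re : ℂ) := by simp
        have h6 : star x • M.1 = (x.re : ℂ) • M.1 + (x.re : ℂ) • M.1 - x • M.1 := by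
          rw [← add_smul, ← h4, add_smul]; abel
        have e1 : x • (star x • (1 : Mat)) = ((x.re : ℂ) * x.re) • 1 + ((x.im : ℂ) ^ 2) • 1 := by
          rw [smul_smul, mul_comm, h3, add_smul]
        simp only [smul_sub]
        rw [e1, h5, h6, smul_smul]
        abel
      calc Bᴴ * (star x • (1 : Mat) - M.1) * ((x • 1 - M.1) * B)
          = Bᴴ * ((star x • (1 : Mat) - M.1) * (x • 1 - M.1)) * B := by noncomm_ring
        _ = _ := by
          rw [h2]
          simp only [mul_add, add_mul, mul_smul_comm, smul_mul_assoc, mul_one, mul_assoc]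
    exact_mod_cast h
  rw [key]
  nlinarith [sq_nonneg ‖((x.re : ℂ) • 1 - M.1) * B‖]

theorem res_unit (M : HermMat N) {x : ℂ} (hx : x.im ≠ 0) : IsUnit (x • 1 - M.1 : Mat) := by
  have : IsArtinianRing (Mat)ᵐᵒᵖ := by
    have : IsArtinian ℂ (Mat)ᵐᵒᵖ := inferInstance
    exact isArtinian_of_tower ℂ this
  rw [IsArtinianRing.isUnit_iff_isLeftRegular, isLeftRegular_iff_right_eq_zero_of_mul]
  intro B hB
  have := res_norm M x B
  rw [hB, norm_zero] at this
  have h0 : 0 < x.im ^ 2 := by positivity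
  have : ‖B‖ ^ 2 ≤ 0 := by
    by_contra! h
    nlinarith [mul_pos h0 h]
  have : ‖B‖ = 0 := by nlinarith [norm_nonneg B]
  simpa using this

/-- The resolvent matrix. -/
def G (x : ℂ) (M : Mat) : Mat := (x • 1 - M)⁻¹

theorem mul_G (M : HermMat N) {x : ℂ} (hx : x.im ≠ 0) : (x • 1 - M.1 : Mat) * G x M.1 = 1 :=
  Matrix.mul_nonsing_inv _ ((Matrix.isUnit_iff_isUnit_det _).1 (res_unit M hx))

theorem G_mul (M : HermMat N) {x : ℂ} (hx : x.im ≠ 0) : G x M.1 * (x • 1 - M.1 : Mat) = 1 :=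
  Matrix.nonsing_inv_mul _ ((Matrix.isUnit_iff_isUnit_det _).1 (res_unit M hx))

theorem G_bound {x : ℂ} (hx : x.im ≠ 0) : ∃ K : ℝ, ∀ M : HermMat N, ‖G x M.1‖ ≤ K := by
  refine ⟨‖(1 : Mat)‖ / |x.im|, fun M => ?_⟩
  have := res_norm M x (G x M.1)
  rw [mul_G M hx] at this
  have h0 : 0 < |x.im| := by positivity
  rw [le_div_iff₀ h0]
  apply le_of_sq_le_sq _ (norm_nonneg _)
  rw [mul_pow, sq_abs]
  linarith

theorem G_hasDerivAt (M H : HermMat N) {x : ℂ} (hx : x.im ≠ 0) :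
    HasDerivAt (fun t : ℝ => G x (M.1 + t • H.1)) (G x M.1 * H.1 * G x M.1) 0 := by
  obtain ⟨u, hu⟩ := res_unit M hx
  have h1 := hasFDerivAt_ringInverse (𝕜 := ℝ) u
  have h2 : HasDerivAt (fun t : ℝ => (x • 1 - (M.1 + t • H.1) : Mat)) (-H.1) 0 := by
    have := (((hasDerivAt_id (0:ℝ)).smul_const H.1).const_add M.1).const_sub (x • (1 : Mat))
    simpa using this
  have h3 : HasFDerivAt Ring.inverse (-ContinuousLinearMap.mulLeftRight ℝ Mat ↑u⁻¹ ↑u⁻¹)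
      ((fun t : ℝ => (x • 1 - (M.1 + t • H.1) : Mat)) 0) := by
    simpa [← hu] using h1
  have h4 := h3.comp_hasDerivAt (0:ℝ) h2
  have h5 : G x M.1 = ↑u⁻¹ := by
    rw [G, ← hu, Matrix.coe_units_inv]
  rw [h5]
  convert! h4 using 1
  · funext t
    simp [G, Matrix.nonsing_inv_eq_ringInverse]
  · simp

theorem G_continuous {x : ℂ} (hx : x.im ≠ 0) : Continuous fun M : HermMat N => G x M.1 := by
  rw [continuous_iff_continuousAt]
  intro M
  obtain ⟨u, hu⟩ := res_unit M hx
  have h1 := NormedRing.inverse_continuousAt u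
  have h2 : ContinuousAt (fun M : HermMat N => (x • 1 - M.1 : Mat)) M :=
    (continuous_const.sub continuous_subtype_val).continuousAt
  rw [hu] at h1
  have := ContinuousAt.comp (f := (fun M : HermMat N => (x • 1 - M.1 : Mat))) h1 h2
  simpa [G, Matrix.nonsing_inv_eq_ringInverse, Function.comp_def] using this

theorem V_mul_G (V : Polynomial ℝ) (M : HermMat N) {x : ℂ} (hx : x.im ≠ 0) :
    Polynomial.aeval M.1 V.derivative * G x M.1 =
      (Polynomial.aeval x V.derivative) • G x M.1 - SVmat V x M.1 := by
  have h := congrArg (· * G x M.1) (SV_mul V x M.1)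
  simp only [mul_assoc, mul_G M hx, sub_mul, smul_mul_assoc, one_mul, mul_one] at h
  rw [h]; abel

theorem pow_deriv (M H : Mat) (n : ℕ) : ∃ D : Mat,
    HasDerivAt (fun t : ℝ => (M + t • H) ^ n) D 0 ∧
    ∀ B, Commute M B → (D * B).trace = (n : ℂ) * (M ^ (n - 1) * H * B).trace := by
  induction n with
  | zero => exact ⟨0, by simpa using! hasDerivAt_const _ _, by simp⟩
  | succ n ih =>
    obtain ⟨D, hD, hB⟩ := ih
    have h2 : HasDerivAt (fun t : ℝ => (M + t • H : Mat)) H 0 := by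
      have := (((hasDerivAt_id (0:ℝ)).smul_const H).const_add M)
      rw [one_smul] at this
      exact this
    refine ⟨D * M + M ^ n * H, ?_, ?_⟩
    · have := hD.mul h2
      simpa [pow_succ] using! this
    · intro B hc
      have h1 := hB (M * B) ((Commute.refl M).mul_right hc)
      rw [add_mul, Matrix.trace_add, mul_assoc, h1, hc.eq]
      rcases n with _ | n
      · simp
      · simp only [Nat.add_sub_cancel]
        rw [← mul_assoc, Matrix.trace_mul_comm, pow_succ' M n]
        simp only [mul_assoc]
        push_cast; ring

theorem V_deriv (V : Polynomial ℝ) (M H : Mat) :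
    HasDerivAt (fun t : ℝ => (Polynomial.aeval (M + t • H) V).trace)
      (Polynomial.aeval M V.derivative * H).trace 0 := by
  have htr : ∀ {f : ℝ → Mat} {D}, HasDerivAt f D 0 → HasDerivAt (fun t => (f t).trace) D.trace 0 := by
    intro f D h
    exact ((Matrix.traceLinearMap (Fin N) ℝ ℂ).toContinuousLinearMap.hasFDerivAt).comp_hasDerivAt 0 h
  induction V using Polynomial.induction_on' with
  | add p q hp hq =>
    simpa [add_mul, Matrix.trace_add] using! hp.add hq
  | monomial n a =>
    obtain ⟨D, hD, hB⟩ := pow_deriv M H n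
    have h1 := hB 1 (Commute.one_right M)
    have := (htr hD).const_smul a
    simp only [mul_one] at h1
    rw [h1] at this
    simp only [Polynomial.aeval_monomial, Polynomial.derivative_monomial]
    convert! this using 1
    · ext t
      simp only [Pi.smul_apply]
      rw [← Algebra.smul_def, Matrix.trace_smul]
    · rw [← Algebra.smul_def, smul_mul_assoc, Matrix.trace_smul, mul_smul]
      congr 1


section PG

variable {E F : Type*} [NormedAddCommGroup E] [NormedAddCommGroup F]

/-- Continuous functions of polynomial growth. -/
def PG (f : E → F) : Prop :=
  Continuous f ∧ ∃ C : ℝ, ∃ k : ℕ, 0 ≤ C ∧ ∀ p, ‖f p‖ ≤ C * (1 + ‖p‖) ^ k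

theorem PG.of_bound {f : E → F} (hf : Continuous f) {K : ℝ} (h : ∀ p, ‖f p‖ ≤ K) : PG f :=
  ⟨hf, |K|, 0, abs_nonneg K, fun p => by simpa using (h p).trans (le_abs_self K)⟩

theorem PG.const (a : F) : PG (fun _ : E => a) := .of_bound continuous_const fun _ => le_rfl

theorem PG.of_le {f : E → F} (hf : Continuous f) (h : ∀ p, ‖f p‖ ≤ ‖p‖) : PG f :=
  ⟨hf, 1, 1, zero_le_one, fun p => by have := h p; simp; linarith⟩

theorem PG.add {f g : E → F} (hf : PG f) (hg : PG g) : PG fun p => f p + g p := by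
  obtain ⟨hf, C, k, hC, h⟩ := hf
  obtain ⟨hg, D, l, hD, h'⟩ := hg
  refine ⟨hf.add hg, C + D, k + l, by positivity, fun p => (norm_add_le _ _).trans ?_⟩
  have h1 : 1 ≤ 1 + ‖p‖ := by linarith [norm_nonneg p]
  have h2 : (1 + ‖p‖) ^ k ≤ (1 + ‖p‖) ^ (k + l) := pow_le_pow_right₀ h1 (by omega)
  have h3 : (1 + ‖p‖) ^ l ≤ (1 + ‖p‖) ^ (k + l) := pow_le_pow_right₀ h1 (by omega)
  nlinarith [h p, h' p, mul_le_mul_of_nonneg_left h2 hC, mul_le_mul_of_nonneg_left h3 hD]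

theorem PG.mul {R : Type*} [NormedRing R] {f g : E → R} (hf : PG f) (hg : PG g) :
    PG fun p => f p * g p := by
  obtain ⟨hf, C, k, hC, h⟩ := hf
  obtain ⟨hg, D, l, hD, h'⟩ := hg
  refine ⟨hf.mul hg, C * D, k + l, by positivity, fun p => (norm_mul_le _ _).trans ?_⟩
  calc ‖f p‖ * ‖g p‖ ≤ (C * (1 + ‖p‖) ^ k) * (D * (1 + ‖p‖) ^ l) := by
        gcongr
        · exact h p
        · exact h' p
    _ = _ := by rw [pow_add]; ring

theorem PG.sum {ι : Type*} (s : Finset ι) {f : ι → E → F} (hf : ∀ i, PG (f i)) :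
    PG fun p => ∑ i ∈ s, f i p := by
  classical
  induction s using Finset.induction_on with
  | empty => simpa using PG.const (0 : F)
  | insert a s ha ih => simpa [Finset.sum_insert ha] using (hf a).add ih

theorem PG.pow {R : Type*} [NormedRing R] {f : E → R} (hf : PG f) (n : ℕ) :
    PG fun p => f p ^ n := by
  induction n with
  | zero => simpa using PG.const (1 : R)
  | succ n ih => simpa [pow_succ] using ih.mul hf

theorem PG.clm {F' : Type*} [NormedAddCommGroup F'] [NormedSpace ℝ F] [NormedSpace ℝ F']
    {f : E → F} (hf : PG f) (L : F →L[ℝ] F') : PG fun p => L (f p) := by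
  obtain ⟨hf, C, k, hC, h⟩ := hf
  refine ⟨L.continuous.comp hf, ‖L‖ * C, k, by positivity, fun p => (L.le_opNorm _).trans ?_⟩
  rw [mul_assoc]
  gcongr
  exact h p

theorem PG.lin {F' : Type*} [NormedAddCommGroup F'] [NormedSpace ℝ F] [NormedSpace ℝ F']
    [FiniteDimensional ℝ F]
    {f : E → F} (hf : PG f) (L : F →ₗ[ℝ] F') : PG fun p => L (f p) :=
  hf.clm (LinearMap.toContinuousLinearMap L)

theorem PG.congr {f g : E → F} (hf : PG f) (h : ∀ p, f p = g p) : PG g := by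
  rwa [← funext h]

theorem poly_gauss (n : ℕ) {a : ℝ} (ha : 0 < a) : ∃ K : ℝ, ∀ r : ℝ, 0 ≤ r →
    (1 + r) ^ n * Real.exp (-a * r ^ 2) ≤ K := by
  refine ⟨n.factorial * Real.exp (1 + 1 / (4 * a)), fun r hr => ?_⟩
  have h1 : (1 + r) ^ n ≤ n.factorial * Real.exp (1 + r) := by
    have := Real.pow_div_factorial_le_exp (1 + r) (by linarith) n
    rwa [div_le_iff₀ (by positivity), mul_comm] at this
  calc (1 + r) ^ n * Real.exp (-a * r ^ 2)
      ≤ n.factorial * Real.exp (1 + r) * Real.exp (-a * r ^ 2) := by gcongr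
    _ = n.factorial * Real.exp (1 + r + -a * r ^ 2) := by rw [mul_assoc, ← Real.exp_add]
    _ ≤ _ := by
      gcongr ?_ * Real.exp ?_
      have : 0 ≤ a * (r - 1 / (2 * a)) ^ 2 := by positivity
      have h2 : a * (r - 1 / (2 * a)) ^ 2 = a * r ^ 2 - r + 1 / (4 * a) := by
        field_simp
        ring
      linarith

variable [NormedSpace ℝ E] [FiniteDimensional ℝ E] [MeasurableSpace E] [BorelSpace E]

theorem PG.integrable {ν : Measure E} [ν.IsAddHaarMeasure] {f w : E → ℂ} (hf : PG f)
    (hw : Continuous w) {K a : ℝ} (ha : 0 < a) (hb : ∀ p, ‖w p‖ ≤ K * Real.exp (-a * ‖p‖ ^ 2)) :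
    Integrable (fun p => f p * w p) ν := by
  obtain ⟨hf, C, k, hC, h⟩ := hf
  set m := Module.finrank ℝ E + 1
  obtain ⟨L, hL⟩ := poly_gauss (k + m) ha
  have hi : Integrable (fun p : E => (1 + ‖p‖) ^ (-(m : ℝ))) ν :=
    integrable_one_add_norm (by simp [m])
  refine (hi.const_mul (C * |K| * L)).mono' (hf.mul hw).aestronglyMeasurable
    (Filter.Eventually.of_forall fun p => ?_)
  have hp : 0 < 1 + ‖p‖ := by linarith [norm_nonneg p]
  rw [norm_mul, Real.rpow_neg hp.le, Real.rpow_natCast, ← div_eq_mul_inv, le_div_iff₀ (by positivity)]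
  calc ‖f p‖ * ‖w p‖ * (1 + ‖p‖) ^ m
      ≤ (C * (1 + ‖p‖) ^ k) * (|K| * Real.exp (-a * ‖p‖ ^ 2)) * (1 + ‖p‖) ^ m := by
        gcongr
        · exact h p
        · exact (hb p).trans (by gcongr; exact le_abs_self K)
    _ = C * |K| * ((1 + ‖p‖) ^ (k + m) * Real.exp (-a * ‖p‖ ^ 2)) := by rw [pow_add]; ring
    _ ≤ _ := by
        gcongr
        exact hL _ (norm_nonneg p)

theorem ibp {ν : Measure E} [ν.IsAddHaarMeasure] {f f' s w : E → ℂ} (hf : PG f) (hf' : PG f')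
    (hs : PG s) (hw : Continuous w) {K a : ℝ} (ha : 0 < a)
    (hb : ∀ p, ‖w p‖ ≤ K * Real.exp (-a * ‖p‖ ^ 2)) (v : E)
    (hd : ∀ p, HasLineDerivAt ℝ f (f' p) p v)
    (hdw : ∀ p, HasLineDerivAt ℝ w (s p * w p) p v) :
    ∫ p, (f' p + f p * s p) * w p ∂ν = 0 := by
  have h := integral_bilinear_hasLineDerivAt_right_eq_neg_left_of_integrable
    (μ := ν) (f := f) (f' := f') (g := w) (g' := fun p => s p * w p) (v := v)
    (B := ContinuousLinearMap.mul ℝ ℂ)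
    (by simpa using hf'.integrable hw ha hb)
    (by simpa [mul_assoc] using (hf.mul hs).integrable hw ha hb)
    (by simpa using hf.integrable hw ha hb) (fun p _ => hd p) (fun p _ => hdw p)
  simp only [ContinuousLinearMap.mul_apply'] at h
  have h2 : ∀ p, (f' p + f p * s p) * w p = f' p * w p + f p * (s p * w p) := fun p => by ring
  simp only [h2]
  rw [integral_add (hf'.integrable hw ha hb)
    (by simpa [mul_assoc] using (hf.mul hs).integrable hw ha hb), h]
  ring

end PG

theorem spec1 (M : HermMat N) : ∃ (U : Mat) (l : Fin N → ℝ), Uᴴ * U = 1 ∧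
    ∀ p : Polynomial ℝ, Polynomial.aeval M.1 p =
      U * Matrix.diagonal (fun i => ((p.eval (l i) : ℝ) : ℂ)) * Uᴴ := by
  have hM : M.1.IsHermitian := M.2
  have hs := hM.spectral_theorem
  set U : Mat := hM.eigenvectorUnitary.1
  have h1 : Uᴴ * U = 1 := Unitary.coe_star_mul_self hM.eigenvectorUnitary
  have h2 : U * Uᴴ = 1 := Unitary.coe_mul_star_self hM.eigenvectorUnitary
  have h3 : M.1 = U * Matrix.diagonal (fun i => ((hM.eigenvalues i : ℝ) : ℂ)) * Uᴴ := hs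
  refine ⟨U, hM.eigenvalues, h1, fun p => ?_⟩
  have hpow : ∀ n : ℕ, M.1 ^ n =
      U * Matrix.diagonal (fun i => (((hM.eigenvalues i) ^ n : ℝ) : ℂ)) * Uᴴ := by
    intro n
    induction n with
    | zero => simp [h2]
    | succ n ih =>
      rw [pow_succ, ih]
      nth_rewrite 2 [h3]
      calc _ = U * Matrix.diagonal (fun i => (((hM.eigenvalues i) ^ n : ℝ) : ℂ)) * (Uᴴ * U) *
            Matrix.diagonal (fun i => ((hM.eigenvalues i : ℝ) : ℂ)) * Uᴴ := by
            simp only [mul_assoc]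
        _ = _ := by
            rw [h1, mul_one, mul_assoc U, Matrix.diagonal_mul_diagonal]
            simp [pow_succ]
  induction p using Polynomial.induction_on' with
  | add p q hp hq =>
    rw [map_add, hp, hq, ← add_mul, ← mul_add, Matrix.diagonal_add]
    simp
  | monomial n a =>
    rw [Polynomial.aeval_monomial, hpow, ← Algebra.smul_def, ← smul_mul_assoc, ← mul_smul_comm,
      ← Matrix.diagonal_smul]
    congr 3
    ext i
    simp

theorem spec2 (M₁ M₂ : HermMat N) : ∃ (l n : Fin N → ℝ) (w : Fin N → Fin N → ℝ),
    (∀ i j, 0 ≤ w i j) ∧ ∀ p q : Polynomial ℝ,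
      (Polynomial.aeval M₁.1 p * Polynomial.aeval M₂.1 q).trace =
        ((∑ i, ∑ j, p.eval (l i) * q.eval (n j) * w i j : ℝ) : ℂ) := by
  obtain ⟨U, l, hU, hl⟩ := spec1 M₁
  obtain ⟨V, n, hV, hn⟩ := spec1 M₂
  refine ⟨l, n, fun i j => ‖(Uᴴ * V) i j‖ ^ 2, fun i j => by positivity, fun p q => ?_⟩
  rw [hl, hn]
  set P := Matrix.diagonal (fun i => ((p.eval (l i) : ℝ) : ℂ)) with hP
  set Q := Matrix.diagonal (fun i => ((q.eval (n i) : ℝ) : ℂ)) with hQ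
  have : (U * P * Uᴴ * (V * Q * Vᴴ)).trace = ((P * (Uᴴ * V)) * (Q * (Uᴴ * V)ᴴ)).trace := by
    rw [Matrix.conjTranspose_mul, Matrix.conjTranspose_conjTranspose]
    calc _ = (U * (P * Uᴴ * (V * Q * Vᴴ))).trace := by simp only [mul_assoc]
      _ = _ := by rw [Matrix.trace_mul_comm]; simp only [mul_assoc]
  rw [this, Matrix.trace]
  push_cast
  refine Finset.sum_congr rfl fun i _ => ?_
  rw [Matrix.diag_apply, Matrix.mul_apply]
  refine Finset.sum_congr rfl fun j _ => ?_
  rw [hP, hQ, Matrix.diagonal_mul, Matrix.diagonal_mul, Matrix.conjTranspose_apply,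
    ← Complex.mul_conj', RCLike.star_def]
  ring

theorem trace_bound {V₁ V₂ : Polynomial ℝ} {c C : ℝ} (h : ∀ x y : ℝ,
      c * (x ^ 2 + y ^ 2) - C ≤ V₁.eval x + V₂.eval y - x * y) (M₁ M₂ : HermMat N) :
    ∃ r : ℝ, c * (‖M₁‖ ^ 2 + ‖M₂‖ ^ 2) - C * N ≤ r ∧
      (Polynomial.aeval M₁.1 V₁ + Polynomial.aeval M₂.1 V₂ - M₁.1 * M₂.1).trace = (r : ℂ) := by
  obtain ⟨l, n, w, hw, hs⟩ := spec2 M₁ M₂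
  have hM₁ : M₁.1ᴴ = M₁.1 := M₁.2
  have hM₂ : M₂.1ᴴ = M₂.1 := M₂.2
  have e0 := hs 1 1
  have e1 := hs V₁ 1
  have e2 := hs 1 V₂
  have e3 := hs .X .X
  have e4 := hs (.X ^ 2) 1
  have e5 := hs 1 (.X ^ 2)
  simp only [map_one, one_mul, mul_one, Polynomial.eval_one, Polynomial.aeval_X,
    Polynomial.eval_X, map_pow, Polynomial.eval_pow, Matrix.trace_one, Fintype.card_fin] at *
  have f4 : ‖M₁‖ ^ 2 = ∑ i, ∑ j, l i ^ 2 * w i j := by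
    have := frob_sq M₁.1
    rw [hM₁, ← sq, e4] at this
    exact_mod_cast this
  have f5 : ‖M₂‖ ^ 2 = ∑ i, ∑ j, n j ^ 2 * w i j := by
    have := frob_sq M₂.1
    rw [hM₂, ← sq, e5] at this
    exact_mod_cast this
  have f0 : (N : ℝ) = ∑ i, ∑ j, w i j := by exact_mod_cast e0
  refine ⟨∑ i, ∑ j, (V₁.eval (l i) + V₂.eval (n j) - l i * n j) * w i j, ?_, ?_⟩
  · calc _ = ∑ i, ∑ j, (c * (l i ^ 2 + n j ^ 2) - C) * w i j := by
          rw [f4, f5, f0, ← Finset.sum_add_distrib, Finset.mul_sum, Finset.mul_sum,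
            ← Finset.sum_sub_distrib]
          refine Finset.sum_congr rfl fun i _ => ?_
          rw [← Finset.sum_add_distrib, Finset.mul_sum, Finset.mul_sum, ← Finset.sum_sub_distrib]
          exact Finset.sum_congr rfl fun j _ => by ring
      _ ≤ _ := by
          exact Finset.sum_le_sum fun i _ => Finset.sum_le_sum fun j _ =>
            mul_le_mul_of_nonneg_right (h _ _) (hw i j)
  · rw [Matrix.trace_sub, Matrix.trace_add, e1, e2, e3]
    norm_cast
    rw [← Finset.sum_add_distrib, ← Finset.sum_sub_distrib]
    refine Finset.sum_congr rfl fun i _ => ?_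
    rw [← Finset.sum_add_distrib, ← Finset.sum_sub_distrib]
    exact Finset.sum_congr rfl fun j _ => by ring


/-- The Boltzmann weight on pairs of Hermitian matrices. -/
def wt (N : ℕ) (T : ℝ) (V₁ V₂ : Polynomial ℝ) (p : HermMat N × HermMat N) : ℂ :=
  hweight N T V₁ V₂ p.1.1 p.2.1

theorem pg_fst : PG fun p : HermMat N × HermMat N => p.1.1 :=
  .of_le (continuous_subtype_val.comp continuous_fst) fun p => norm_fst_le p

theorem pg_snd : PG fun p : HermMat N × HermMat N => p.2.1 :=
  .of_le (continuous_subtype_val.comp continuous_snd) fun p => norm_snd_le p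

section

variable {E : Type*} [NormedAddCommGroup E]

theorem PG.trace {f : E → Mat} (hf : PG f) : PG fun p => (f p).trace :=
  hf.lin (Matrix.traceLinearMap (Fin N) ℝ ℂ)

theorem PG.entry {f : E → Mat} (hf : PG f) (i j : Fin N) : PG fun p => f p i j :=
  hf.lin (Matrix.entryLinearMap ℝ ℂ i j)

theorem PG.csmul {f : E → Mat} (hf : PG f) (a : ℂ) : PG fun p => a • f p :=
  (PG.mul (PG.const (a • (1 : Mat))) hf).congr fun p => by simp

theorem PG.sub {f g : E → Mat} (hf : PG f) (hg : PG g) : PG fun p => f p - g p :=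
  (hf.add (hg.csmul (-1))).congr fun p => by simp [sub_eq_add_neg]

theorem PG.aeval {f : E → Mat} (hf : PG f) (V : Polynomial ℝ) :
    PG fun p => Polynomial.aeval (f p) V := by
  simp only [Polynomial.aeval_eq_sum_range]
  refine PG.sum _ fun i => ?_
  exact ((hf.pow i).csmul (V.coeff i : ℂ)).congr fun p => by simp

theorem PG.sv {f : E → Mat} (hf : PG f) (V : Polynomial ℝ) (z : ℂ) :
    PG fun p => SVmat V z (f p) := by
  unfold SVmat
  exact PG.sum _ fun i => PG.csmul (PG.sum _ fun l => PG.csmul (hf.pow _) _) _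

end

theorem pg_G {x : ℂ} (hx : x.im ≠ 0) : PG fun p : HermMat N × HermMat N => G x p.1.1 := by
  obtain ⟨K, hK⟩ := G_bound (N := N) hx
  exact .of_bound ((G_continuous hx).comp continuous_fst) fun p => hK p.1

theorem wt_continuous (T : ℝ) (V₁ V₂ : Polynomial ℝ) : Continuous (wt N T V₁ V₂) := by
  have h : PG fun p : HermMat N × HermMat N =>
      (Polynomial.aeval p.1.1 V₁ + Polynomial.aeval p.2.1 V₂ - p.1.1 * p.2.1).trace :=
    (((pg_fst.aeval V₁).add (pg_snd.aeval V₂)).sub (pg_fst.mul pg_snd)).trace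
  exact Complex.continuous_exp.comp (continuous_const.mul h.1)

theorem wt_bound (hN : 1 ≤ N) {T : ℝ} (hT : 0 < T) {V₁ V₂ : Polynomial ℝ} {c C : ℝ} (hc : 0 < c)
    (h : ∀ x y : ℝ, c * (x ^ 2 + y ^ 2) - C ≤ V₁.eval x + V₂.eval y - x * y) :
    ∃ K a : ℝ, 0 < a ∧ ∀ p, ‖wt N T V₁ V₂ p‖ ≤ K * Real.exp (-a * ‖p‖ ^ 2) := by
  have hN' : (0 : ℝ) < N := by exact_mod_cast hN
  refine ⟨Real.exp (N / T * (C * N)), N / T * c, by positivity, fun p => ?_⟩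
  obtain ⟨r, hr, hr'⟩ := trace_bound h p.1 p.2
  rw [wt, hweight, hr', Complex.norm_exp, ← Real.exp_add]
  apply Real.exp_le_exp.2
  have h1 : (-((N : ℂ) / (T : ℂ)) * (r : ℂ)).re = -(N / T * r) := by
    have : (-((N : ℂ) / (T : ℂ)) * (r : ℂ)) = ((-(N / T * r) : ℝ) : ℂ) := by push_cast; ring
    rw [this, Complex.ofReal_re]
  rw [h1]
  have h2 : ‖p‖ ^ 2 ≤ ‖p.1‖ ^ 2 + ‖p.2‖ ^ 2 := by
    rw [Prod.norm_def]
    rcases max_cases ‖p.1‖ ‖p.2‖ with h | h <;> rw [h.1] <;> nlinarith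
  have h3 : c * ‖p‖ ^ 2 - C * N ≤ r := by nlinarith
  have h4 : (0 : ℝ) < N / T := by positivity
  nlinarith [mul_le_mul_of_nonneg_left h3 h4.le]

theorem wt_deriv₁ (T : ℝ) (V₁ V₂ : Polynomial ℝ) (H : HermMat N) (p : HermMat N × HermMat N) :
    HasLineDerivAt ℝ (wt N T V₁ V₂)
      (-((N : ℂ) / (T : ℂ)) * ((Polynomial.aeval p.1.1 V₁.derivative - p.2.1) * H.1).trace *
        wt N T V₁ V₂ p) p (H, 0) := by
  have h1 := V_deriv V₁ p.1.1 H.1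
  have h2 : HasDerivAt (fun t : ℝ => ((p.1.1 + t • H.1) * p.2.1).trace) (p.2.1 * H.1).trace 0 := by
    have := ((hasDerivAt_id (0 : ℝ)).smul_const (H.1 * p.2.1).trace).const_add (p.1.1 * p.2.1).trace
    rw [one_smul, Matrix.trace_mul_comm H.1 p.2.1] at this
    convert! this using 1
    funext t
    simp [add_mul, Matrix.trace_add, Matrix.trace_smul]
    exact Or.inl (Matrix.trace_mul_comm _ _)
  have h3 := ((h1.add_const (Polynomial.aeval p.2.1 V₂).trace).sub h2).const_mul
    (-((N : ℂ) / (T : ℂ)))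
  have h4 := h3.cexp
  unfold HasLineDerivAt
  convert! h4 using 1
  · funext t
    simp [wt, hweight, Matrix.trace_add, Matrix.trace_sub]
  · simp [wt, hweight, Matrix.trace_add, Matrix.trace_sub, sub_mul]
    ring

theorem wt_deriv₂ (T : ℝ) (V₁ V₂ : Polynomial ℝ) (H : HermMat N) (p : HermMat N × HermMat N) :
    HasLineDerivAt ℝ (wt N T V₁ V₂)
      (-((N : ℂ) / (T : ℂ)) * ((Polynomial.aeval p.2.1 V₂.derivative - p.1.1) * H.1).trace *
        wt N T V₁ V₂ p) p (0, H) := by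
  have h1 := V_deriv V₂ p.2.1 H.1
  have h2 : HasDerivAt (fun t : ℝ => (p.1.1 * (p.2.1 + t • H.1)).trace) (p.1.1 * H.1).trace 0 := by
    have := ((hasDerivAt_id (0 : ℝ)).smul_const (p.1.1 * H.1).trace).const_add (p.1.1 * p.2.1).trace
    rw [one_smul] at this
    convert! this using 1
    funext t
    simp [mul_add, Matrix.trace_add, Matrix.trace_smul]
  have h3 := ((h1.const_add (Polynomial.aeval p.1.1 V₁).trace).sub h2).const_mul
    (-((N : ℂ) / (T : ℂ)))
  have h4 := h3.cexp
  unfold HasLineDerivAt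
  convert! h4 using 1
  · funext t
    simp [wt, hweight, Matrix.trace_add, Matrix.trace_sub]
  · simp [wt, hweight, Matrix.trace_add, Matrix.trace_sub, sub_mul]
    ring

theorem entry_deriv {f : ℝ → Mat} {D : Mat} (h : HasDerivAt f D 0) (i j : Fin N) :
    HasDerivAt (fun t => f t i j) (D i j) 0 :=
  ((Matrix.entryLinearMap ℝ ℂ i j).toContinuousLinearMap.hasFDerivAt).comp_hasDerivAt 0 h

section main

variable {T : ℝ} {V₁ V₂ : Polynomial ℝ} [MeasurableSpace (HermMat N)] [BorelSpace (HermMat N)]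
  {μ : Measure (HermMat N)} [μ.IsAddHaarMeasure]
  {K a : ℝ}

theorem borel_prod : BorelSpace (HermMat N × HermMat N) := by
  have : SecondCountableTopology (HermMat N) := inferInstance
  exact inferInstance

theorem haar_prod : (μ.prod μ).IsAddHaarMeasure := by
  have : SecondCountableTopology (HermMat N) := inferInstance
  have : BorelSpace (HermMat N × HermMat N) := inferInstance
  have : SigmaFinite μ := inferInstance
  exact inferInstance

theorem int_add {ν : Measure (HermMat N × HermMat N)} {f g : HermMat N × HermMat N → ℂ}
    (hf : Integrable f ν) (hg : Integrable g ν) : Integrable (fun p => f p + g p) ν := hf.add hg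

theorem pg_int (ha : 0 < a) (hb : ∀ p, ‖wt N T V₁ V₂ p‖ ≤ K * Real.exp (-a * ‖p‖ ^ 2))
    {f : HermMat N × HermMat N → ℂ} (hf : PG f) :
    Integrable (fun p => f p * wt N T V₁ V₂ p) (μ.prod μ) := by
  have := borel_prod (N := N)
  have := haar_prod (μ := μ)
  exact hf.integrable (wt_continuous T V₁ V₂) ha hb

theorem complexify (ha : 0 < a) (hb : ∀ p, ‖wt N T V₁ V₂ p‖ ≤ K * Real.exp (-a * ‖p‖ ^ 2))
    (Φ : HermMat N × HermMat N → Mat →ₗ[ℂ] ℂ) (hΦ : ∀ B, PG fun p => Φ p B)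
    (h0 : ∀ H : HermMat N, ∫ p, Φ p H.1 * wt N T V₁ V₂ p ∂(μ.prod μ) = 0) (B : Mat) :
    ∫ p, Φ p B * wt N T V₁ V₂ p ∂(μ.prod μ) = 0 := by
  have hB := realPart_add_I_smul_imaginaryPart B
  set H₁ := realPart B
  set H₂ := imaginaryPart B
  rw [← hB]
  have : ∀ p, Φ p (H₁.1 + Complex.I • H₂.1) * wt N T V₁ V₂ p =
      Φ p H₁.1 * wt N T V₁ V₂ p + Complex.I * (Φ p H₂.1 * wt N T V₁ V₂ p) := by
    intro p
    rw [map_add, map_smul, smul_eq_mul]; ring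
  simp only [this]
  rw [integral_add (pg_int ha hb (hΦ _)) ((pg_int ha hb (hΦ _)).const_mul _), integral_const_mul,
    h0, h0]
  simp

/-- The linear form `B ↦ (L B R)ᵢⱼ + (b · tr(X B))`. -/
def form (L R X : Mat) (b : ℂ) (i j : Fin N) : Mat →ₗ[ℂ] ℂ where
  toFun B := (L * B * R) i j + b * (X * B).trace
  map_add' A B := by simp [mul_add, add_mul, Matrix.trace_add]; ring
  map_smul' c B := by simp [Matrix.trace_smul]; ring

theorem loop₁ (ha : 0 < a) (hb : ∀ p, ‖wt N T V₁ V₂ p‖ ≤ K * Real.exp (-a * ‖p‖ ^ 2))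
    {x : ℂ} (hx : x.im ≠ 0) (y : ℂ) :
    ∫ p, ((G x p.1.1 * SVmat V₂ y p.2.1).trace * (G x p.1.1).trace +
      (-((N : ℂ) / (T : ℂ))) * ((G x p.1.1 * SVmat V₂ y p.2.1) *
        (Polynomial.aeval p.1.1 V₁.derivative - p.2.1)).trace) * wt N T V₁ V₂ p ∂(μ.prod μ) = 0 := by
  have hG := pg_G (N := N) hx
  have hS := (pg_snd (N := N)).sv V₂ y
  have hX := ((pg_fst (N := N)).aeval V₁.derivative).sub pg_snd
  let Φ (i j : Fin N) (p : HermMat N × HermMat N) : Mat →ₗ[ℂ] ℂ :=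
    form (G x p.1.1) (G x p.1.1 * SVmat V₂ y p.2.1)
      (Polynomial.aeval p.1.1 V₁.derivative - p.2.1)
      ((G x p.1.1 * SVmat V₂ y p.2.1) i j * (-((N : ℂ) / (T : ℂ)))) i j
  have hΦ : ∀ i j B, PG fun p => Φ i j p B := fun i j B =>
    (((hG.mul (PG.const B)).mul (hG.mul hS)).entry i j).add
      ((((hG.mul hS).entry i j).mul (PG.const _)).mul (hX.mul (PG.const B)).trace)
  have h0 : ∀ i j (H : HermMat N), ∫ p, Φ i j p H.1 * wt N T V₁ V₂ p ∂(μ.prod μ) = 0 := by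
    intro i j H
    have := borel_prod (N := N)
    have := haar_prod (μ := μ)
    have := ibp (ν := μ.prod μ) (f := fun p => (G x p.1.1 * SVmat V₂ y p.2.1) i j)
      (f' := fun p => (G x p.1.1 * H.1 * (G x p.1.1 * SVmat V₂ y p.2.1)) i j)
      (s := fun p => -((N : ℂ) / (T : ℂ)) *
        ((Polynomial.aeval p.1.1 V₁.derivative - p.2.1) * H.1).trace)
      ((hG.mul hS).entry i j) (((hG.mul (PG.const _)).mul (hG.mul hS)).entry i j)
      ((PG.const _).mul (hX.mul (PG.const _)).trace) (wt_continuous T V₁ V₂) ha hb (H, 0)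
      (fun p => by
        have h := entry_deriv ((G_hasDerivAt p.1 H hx).mul_const (SVmat V₂ y p.2.1)) i j
        unfold HasLineDerivAt
        convert! h using 1
        · funext t
          simp
        · simp only [mul_assoc])
      (wt_deriv₁ T V₁ V₂ H)
    rw [← this]
    congr 1
    funext p
    simp only [Φ, form, LinearMap.coe_mk, AddHom.coe_mk]
    ring
  have h1 := fun i j => complexify ha hb (Φ i j) (hΦ i j) (h0 i j) (Matrix.single i j 1)
  have h2 : ∀ p, ((G x p.1.1 * SVmat V₂ y p.2.1).trace * (G x p.1.1).trace +
      (-((N : ℂ) / (T : ℂ))) * ((G x p.1.1 * SVmat V₂ y p.2.1) *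
        (Polynomial.aeval p.1.1 V₁.derivative - p.2.1)).trace) * wt N T V₁ V₂ p =
      ∑ i, ∑ j, Φ i j p (Matrix.single i j 1) * wt N T V₁ V₂ p := by
    intro p
    simp only [← Finset.sum_mul]
    congr 1
    simp only [Φ, form, LinearMap.coe_mk, AddHom.coe_mk]
    generalize G x p.1.1 = g
    generalize SVmat V₂ y p.2.1 = S
    generalize Polynomial.aeval p.1.1 V₁.derivative - p.2.1 = X
    simp only [Finset.sum_add_distrib]
    congr 1
    · rw [mul_comm, Matrix.trace, Matrix.trace, Finset.sum_mul_sum]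
      refine Finset.sum_congr rfl fun i _ => Finset.sum_congr rfl fun j _ => ?_
      rw [mul_assoc, Matrix.mul_apply, Finset.sum_eq_single i]
      · simp
      · intro k _ hk
        rw [Matrix.single_mul_apply_of_ne _ _ _ _ _ hk, mul_zero]
      · simp
    · rw [Matrix.trace, Finset.mul_sum]
      refine Finset.sum_congr rfl fun i _ => ?_
      rw [Matrix.diag_apply, Matrix.mul_apply, Finset.mul_sum]
      refine Finset.sum_congr rfl fun j _ => ?_
      rw [Matrix.trace_mul_single]
      simp
      ring
  simp only [h2]
  rw [integral_finsetSum _ fun i _ => integrable_finsetSum _ fun j _ => pg_int ha hb (hΦ i j _)]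
  refine Finset.sum_eq_zero fun i _ => ?_
  rw [integral_finsetSum _ fun j _ => pg_int ha hb (hΦ i j _)]
  exact Finset.sum_eq_zero fun j _ => h1 i j

theorem loop₂ (ha : 0 < a) (hb : ∀ p, ‖wt N T V₁ V₂ p‖ ≤ K * Real.exp (-a * ‖p‖ ^ 2))
    {x : ℂ} (hx : x.im ≠ 0) :
    ∫ p, (-((N : ℂ) / (T : ℂ))) * (G x p.1.1 *
        (Polynomial.aeval p.2.1 V₂.derivative - p.1.1)).trace * wt N T V₁ V₂ p ∂(μ.prod μ) = 0 := by
  have hG := pg_G (N := N) hx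
  have hX := ((pg_snd (N := N)).aeval V₂.derivative).sub pg_fst
  let Φ (i j : Fin N) (p : HermMat N × HermMat N) : Mat →ₗ[ℂ] ℂ :=
    form 0 0 (Polynomial.aeval p.2.1 V₂.derivative - p.1.1)
      ((G x p.1.1) i j * (-((N : ℂ) / (T : ℂ)))) i j
  have hΦ : ∀ i j B, PG fun p => Φ i j p B := fun i j B =>
    (PG.const _).add (((hG.entry i j).mul (PG.const _)).mul (hX.mul (PG.const B)).trace)
  have h0 : ∀ i j (H : HermMat N), ∫ p, Φ i j p H.1 * wt N T V₁ V₂ p ∂(μ.prod μ) = 0 := by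
    intro i j H
    have := borel_prod (N := N)
    have := haar_prod (μ := μ)
    have := ibp (ν := μ.prod μ) (f := fun p => (G x p.1.1) i j)
      (f' := fun p => 0)
      (s := fun p => -((N : ℂ) / (T : ℂ)) *
        ((Polynomial.aeval p.2.1 V₂.derivative - p.1.1) * H.1).trace)
      (hG.entry i j) (PG.const _)
      ((PG.const _).mul (hX.mul (PG.const _)).trace) (wt_continuous T V₁ V₂) ha hb (0, H)
      (fun p => by
        unfold HasLineDerivAt
        convert! hasDerivAt_const (0 : ℝ) (G x p.1.1 i j) using 1
        funext t
        simp)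
      (wt_deriv₂ T V₁ V₂ H)
    rw [← this]
    congr 1
    funext p
    simp only [Φ, form, LinearMap.coe_mk, AddHom.coe_mk]
    simp only [zero_mul, mul_zero, Matrix.zero_apply, zero_add]
    ring
  have h1 := fun i j => complexify ha hb (Φ i j) (hΦ i j) (h0 i j) (Matrix.single i j 1)
  have h2 : ∀ p, (-((N : ℂ) / (T : ℂ))) * (G x p.1.1 *
        (Polynomial.aeval p.2.1 V₂.derivative - p.1.1)).trace * wt N T V₁ V₂ p =
      ∑ i, ∑ j, Φ i j p (Matrix.single i j 1) * wt N T V₁ V₂ p := by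
    intro p
    simp only [← Finset.sum_mul]
    congr 1
    simp only [Φ, form, LinearMap.coe_mk, AddHom.coe_mk]
    generalize G x p.1.1 = g
    generalize Polynomial.aeval p.2.1 V₂.derivative - p.1.1 = X
    rw [Matrix.trace, Finset.mul_sum]
    refine Finset.sum_congr rfl fun i _ => ?_
    rw [Matrix.diag_apply, Matrix.mul_apply, Finset.mul_sum]
    refine Finset.sum_congr rfl fun j _ => ?_
    rw [Matrix.trace_mul_single]
    simp
    ring
  simp only [h2]
  rw [integral_finsetSum _ fun i _ => integrable_finsetSum _ fun j _ => pg_int ha hb (hΦ i j _)]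
  refine Finset.sum_eq_zero fun i _ => ?_
  rw [integral_finsetSum _ fun j _ => pg_int ha hb (hΦ i j _)]
  exact Finset.sum_eq_zero fun j _ => h1 i j

theorem Z_ne_zero {c C : ℝ} (h : ∀ x y : ℝ,
      c * (x ^ 2 + y ^ 2) - C ≤ V₁.eval x + V₂.eval y - x * y)
    (ha : 0 < a) (hb : ∀ p, ‖wt N T V₁ V₂ p‖ ≤ K * Real.exp (-a * ‖p‖ ^ 2)) :
    ∫ p, wt N T V₁ V₂ p ∂(μ.prod μ) ≠ 0 := by
  choose r hr hr' using fun p : HermMat N × HermMat N => trace_bound h p.1 p.2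
  have e : ∀ p, wt N T V₁ V₂ p = ((Real.exp (-(N / T) * r p) : ℝ) : ℂ) := by
    intro p
    rw [wt, hweight, hr']
    push_cast
    rfl
  have hi : Integrable (fun p => wt N T V₁ V₂ p) (μ.prod μ) := by
    simpa using pg_int (μ := μ) ha hb (PG.const (1 : ℂ))
  have hi' : Integrable (fun p => Real.exp (-(N / T) * r p)) (μ.prod μ) := by
    have := hi.re
    simpa only [e, RCLike.re_to_complex, Complex.ofReal_re] using this
  have := integral_exp_pos hi'
  simp only [e]
  rw [integral_complex_ofReal]
  exact_mod_cast this.ne'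

theorem pointwise {x : ℂ} (hx : x.im ≠ 0) (y : ℂ) (p : HermMat N × HermMat N) :
    ((G x p.1.1 * SVmat V₂ y p.2.1) * (Polynomial.aeval p.1.1 V₁.derivative - p.2.1)).trace =
      (Polynomial.aeval x V₁.derivative - y) * (G x p.1.1 * SVmat V₂ y p.2.1).trace
      - (SVmat V₁ x p.1.1 * SVmat V₂ y p.2.1).trace
      + (Polynomial.aeval y V₂.derivative - x) * (G x p.1.1).trace + N
      - (G x p.1.1 * (Polynomial.aeval p.2.1 V₂.derivative - p.1.1)).trace := by
  have e1 := V_mul_G V₁ p.1 hx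
  have e2 := SV_mul V₂ y p.2.1
  have e3 := G_mul p.1 hx
  generalize G x p.1.1 = g at *
  generalize SVmat V₂ y p.2.1 = S at *
  generalize Polynomial.aeval p.1.1 V₁.derivative = D₁ at *
  generalize Polynomial.aeval p.2.1 V₂.derivative = D₂ at *
  have f1 : (g * S * D₁).trace = Polynomial.aeval x V₁.derivative * (g * S).trace
      - (SVmat V₁ x p.1.1 * S).trace := by
    rw [Matrix.trace_mul_comm, ← mul_assoc, e1, sub_mul, Matrix.trace_sub, smul_mul_assoc,
      Matrix.trace_smul, smul_eq_mul]
  have f2 : y * (g * S).trace - (g * S * p.2.1).trace =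
      Polynomial.aeval y V₂.derivative * g.trace - (g * D₂).trace := by
    have := congrArg (fun Z => (g * Z).trace) e2
    simpa [mul_sub, ← mul_assoc, Matrix.trace_sub, Matrix.trace_smul] using this
  have f3 : x * g.trace - (g * p.1.1).trace = N := by
    have := congrArg Matrix.trace e3
    simpa [mul_sub, Matrix.trace_sub, Matrix.trace_smul] using this
  rw [mul_sub, Matrix.trace_sub, mul_sub, Matrix.trace_sub, f1]
  linear_combination f2 + f3

theorem main (hN : 1 ≤ N) (hT : 0 < T)
    (hconf : ∃ c > (0 : ℝ), ∃ C : ℝ, ∀ x y : ℝ,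
      c * (x ^ 2 + y ^ 2) - C ≤ V₁.eval x + V₂.eval y - x * y) {x : ℂ} (hx : x.im ≠ 0) (y : ℂ) :
    (y - Yfun N T V₁ V₂ μ x) *
          ((T : ℂ) * Ufun N T V₁ V₂ μ x y - Polynomial.aeval y V₂.derivative + x) +
        ((T : ℂ) ^ 2 / (N : ℂ) ^ 2) * Uconn N T V₁ V₂ μ x y x
      = Efun N T V₁ V₂ μ x y := by
  obtain ⟨c, hc, C, h⟩ := hconf
  obtain ⟨K, a, ha, hb⟩ := wt_bound hN hT hc h
  have hZ := Z_ne_zero (μ := μ) h ha hb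
  have l1 := loop₁ (μ := μ) ha hb hx y
  have l2 := loop₂ (μ := μ) ha hb hx
  have hG := pg_G (N := N) hx
  have hS := (pg_snd (N := N)).sv V₂ y
  have hS1 := (pg_fst (N := N)).sv V₁ x
  have hX := ((pg_snd (N := N)).aeval V₂.derivative).sub pg_fst
  have i1 := pg_int (μ := μ) ha hb ((hG.mul hS).trace.mul hG.trace)
  have i2 := pg_int (μ := μ) ha hb (hG.mul hS).trace
  have i3 := pg_int (μ := μ) ha hb (hS1.mul hS).trace
  have i4 := pg_int (μ := μ) ha hb hG.trace
  have i5 := pg_int (μ := μ) ha hb (PG.const (1 : ℂ))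
  have i6 := pg_int (μ := μ) ha hb ((PG.const (-((N : ℂ) / (T : ℂ)))).mul (hG.mul hX).trace)
  have hN0 : (N : ℂ) ≠ 0 := by exact_mod_cast (by omega : N ≠ 0)
  have hT0 : (T : ℂ) ≠ 0 := by exact_mod_cast hT.ne'
  simp only [pointwise hx y] at l1
  have e : ∀ p : HermMat N × HermMat N,
    ((G x p.1.1 * SVmat V₂ y p.2.1).trace * (G x p.1.1).trace + (-((N : ℂ) / (T : ℂ))) *
      ((Polynomial.aeval x V₁.derivative - y) * (G x p.1.1 * SVmat V₂ y p.2.1).trace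
      - (SVmat V₁ x p.1.1 * SVmat V₂ y p.2.1).trace
      + (Polynomial.aeval y V₂.derivative - x) * (G x p.1.1).trace + N
      - (G x p.1.1 * (Polynomial.aeval p.2.1 V₂.derivative - p.1.1)).trace)) * wt N T V₁ V₂ p =
    ((((((G x p.1.1 * SVmat V₂ y p.2.1).trace * (G x p.1.1).trace) * wt N T V₁ V₂ p +
     (-((N : ℂ) / (T : ℂ)) * (Polynomial.aeval x V₁.derivative - y)) *
      ((G x p.1.1 * SVmat V₂ y p.2.1).trace * wt N T V₁ V₂ p)) +
     ((N : ℂ) / (T : ℂ)) * ((SVmat V₁ x p.1.1 * SVmat V₂ y p.2.1).trace * wt N T V₁ V₂ p)) +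
     (-((N : ℂ) / (T : ℂ)) * (Polynomial.aeval y V₂.derivative - x)) *
      ((G x p.1.1).trace * wt N T V₁ V₂ p)) +
     (-((N : ℂ) / (T : ℂ)) * N) * (1 * wt N T V₁ V₂ p)) -
     (-((N : ℂ) / (T : ℂ)) * (G x p.1.1 *
       (Polynomial.aeval p.2.1 V₂.derivative - p.1.1)).trace) * wt N T V₁ V₂ p := by
    intro p; ring
  simp only [e] at l1
  have j1 := int_add i1 (i2.const_mul (-((N : ℂ) / (T : ℂ)) * (Polynomial.aeval x V₁.derivative - y)))
  have j2 := int_add j1 (i3.const_mul ((N : ℂ) / (T : ℂ)))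
  have j3 := int_add j2 (i4.const_mul (-((N : ℂ) / (T : ℂ)) * (Polynomial.aeval y V₂.derivative - x)))
  have j4 := int_add j3 (i5.const_mul (-((N : ℂ) / (T : ℂ)) * N))
  rw [integral_sub j4 i6, l2, integral_add j3 (i5.const_mul _), integral_add j2 (i4.const_mul _),
    integral_add j1 (i3.const_mul _), integral_add i1 (i2.const_mul _)] at l1
  simp only [integral_const_mul, one_mul] at l1
  simp only [Efun, Pfun, Uconn, Ufun, Yfun, resolvent1, expectation]
  simp only [wt, G] at l1 hZ
  generalize (∫ p : HermMat N × HermMat N, hweight N T V₁ V₂ p.1.1 p.2.1 ∂(μ.prod μ)) = Z at *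
  generalize (∫ p : HermMat N × HermMat N, ((x • 1 - p.1.1)⁻¹ * SVmat V₂ y p.2.1).trace *
    ((x • 1 - p.1.1)⁻¹).trace * hweight N T V₁ V₂ p.1.1 p.2.1 ∂(μ.prod μ)) = I1 at *
  generalize (∫ p : HermMat N × HermMat N, ((x • 1 - p.1.1)⁻¹ * SVmat V₂ y p.2.1).trace *
    hweight N T V₁ V₂ p.1.1 p.2.1 ∂(μ.prod μ)) = I2 at *
  generalize (∫ p : HermMat N × HermMat N, (SVmat V₁ x p.1.1 * SVmat V₂ y p.2.1).trace *
    hweight N T V₁ V₂ p.1.1 p.2.1 ∂(μ.prod μ)) = I3 at *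
  generalize (∫ p : HermMat N × HermMat N,
    ((x • 1 - p.1.1)⁻¹).trace * hweight N T V₁ V₂ p.1.1 p.2.1 ∂(μ.prod μ)) = I4 at *
  have l1' : I1 = ((N : ℂ) / T) * ((Polynomial.aeval x V₁.derivative - y) * I2 - I3 +
    (Polynomial.aeval y V₂.derivative - x) * I4 + N * Z) := by
    linear_combination l1
  rw [l1']
  field_simp
  ring

end main


end LoopEq
end LoopEq


theorem loop_equation_exact
    (N : ℕ) (hN : 1 ≤ N) (T : ℝ) (hT : 0 < T) (V₁ V₂ : Polynomial ℝ)
    (hconf : ∃ c > (0 : ℝ), ∃ C : ℝ, ∀ x y : ℝ,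
      c * (x ^ 2 + y ^ 2) - C ≤ V₁.eval x + V₂.eval y - x * y)
    [MeasurableSpace (HermMat N)] [BorelSpace (HermMat N)]
    (μ : Measure (HermMat N)) [μ.IsAddHaarMeasure] :
    ∀ x : ℂ, x.im ≠ 0 → ∀ y : ℂ,
      (y - Yfun N T V₁ V₂ μ x) *
          ((T : ℂ) * Ufun N T V₁ V₂ μ x y - Polynomial.aeval y V₂.derivative + x) +
        ((T : ℂ) ^ 2 / (N : ℂ) ^ 2) * Uconn N T V₁ V₂ μ x y x
      = Efun N T V₁ V₂ μ x y := by
  intro x hx y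
  exact @LoopEq.main N T V₁ V₂ _ ‹BorelSpace (HermMat N)› μ ‹μ.IsAddHaarMeasure› hN hT hconf x hx y
end

section
/- Master loop equation of the two-matrix model: for every x ∈ ℂ with Im x ≠ 0, one has E(x, Y(x)) = (T²/N²)·U(x, Y(x); x). -/
open MeasureTheory Matrix

section loop
open scoped Matrix.Norms.Frobenius
open Polynomial

variable {N : ℕ}

lemma loop_frob_sq (M : Matrix (Fin N) (Fin N) ℂ) : ‖M‖ ^ 2 = ∑ i, ∑ j, ‖M i j‖ ^ 2 := by
  rw [Matrix.frobenius_norm_def, ← Real.sqrt_eq_rpow, Real.sq_sqrt]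
  · simp
  · positivity

lemma loop_spec (M : Matrix (Fin N) (Fin N) ℂ) (hM : M.IsHermitian) :
    ∃ (U : Matrix (Fin N) (Fin N) ℂ) (a : Fin N → ℝ), Uᴴ * U = 1 ∧ U * Uᴴ = 1 ∧
      M = U * diagonal (fun i => (a i : ℂ)) * Uᴴ := by
  refine ⟨hM.eigenvectorUnitary, hM.eigenvalues, ?_, ?_, ?_⟩
  · exact Unitary.coe_star_mul_self _
  · exact Unitary.coe_mul_star_self _
  · conv_lhs => rw [hM.spectral_theorem, Unitary.conjStarAlgAut_apply]
    rfl

lemma loop_conj_pow (U D : Matrix (Fin N) (Fin N) ℂ) (h : Uᴴ * U = 1) (h' : U * Uᴴ = 1) (n : ℕ) :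
    (U * D * Uᴴ) ^ n = U * D ^ n * Uᴴ := by
  induction n with
  | zero => simp [h']
  | succ n ih =>
    rw [pow_succ, ih, pow_succ]
    calc U * D ^ n * Uᴴ * (U * D * Uᴴ) = U * D ^ n * (Uᴴ * U) * D * Uᴴ := by
          simp only [Matrix.mul_assoc]
      _ = _ := by rw [h]; simp only [Matrix.mul_assoc, Matrix.mul_one]

lemma loop_trace_conj (U D : Matrix (Fin N) (Fin N) ℂ) (h : Uᴴ * U = 1) :
    (U * D * Uᴴ).trace = D.trace := by
  rw [Matrix.trace_mul_comm, ← Matrix.mul_assoc, h, Matrix.one_mul]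

lemma loop_trace_aeval (U : Matrix (Fin N) (Fin N) ℂ) (a : Fin N → ℝ) (h : Uᴴ * U = 1)
    (h' : U * Uᴴ = 1) (V : ℝ[X]) :
    (aeval (U * diagonal (fun i => (a i : ℂ)) * Uᴴ) V).trace = ((∑ i, V.eval (a i) : ℝ) : ℂ) := by
  induction V using Polynomial.induction_on' with
  | add p q hp hq => simp [hp, hq, Finset.sum_add_distrib]
  | monomial n r =>
    rw [aeval_monomial, loop_conj_pow _ _ h h', ← Algebra.smul_def, Matrix.trace_smul,
      loop_trace_conj _ _ h, Matrix.diagonal_pow, Matrix.trace_diagonal]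
    simp [Finset.mul_sum]

lemma loop_row (W : Matrix (Fin N) (Fin N) ℂ) (h : W * Wᴴ = 1) (i : Fin N) :
    ∑ j, ‖W i j‖ ^ 2 = 1 := by
  have := congrFun (congrFun h i) i
  rw [Matrix.mul_apply] at this
  simp only [Matrix.conjTranspose_apply, Matrix.one_apply_eq, RCLike.star_def,
    Complex.mul_conj, Complex.normSq_eq_norm_sq] at this
  exact_mod_cast this

lemma loop_norm_herm (U : Matrix (Fin N) (Fin N) ℂ) (a : Fin N → ℝ) (h : Uᴴ * U = 1)
    (h' : U * Uᴴ = 1) (M : Matrix (Fin N) (Fin N) ℂ) (hM : M.IsHermitian)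
    (e : M = U * diagonal (fun i => (a i : ℂ)) * Uᴴ) : ‖M‖ ^ 2 = ∑ i, (a i) ^ 2 := by
  have h1 := loop_trace_aeval U a h h' (X ^ 2)
  rw [← e] at h1
  have h2 : (M * Mᴴ).trace = ((‖M‖ ^ 2 : ℝ) : ℂ) := by
    rw [loop_frob_sq]
    simp only [Matrix.trace, Matrix.diag_apply, Matrix.mul_apply, Matrix.conjTranspose_apply,
      RCLike.star_def, Complex.mul_conj, Complex.normSq_eq_norm_sq]
    push_cast; rfl
  rw [hM.eq] at h2
  simp only [map_pow, aeval_X, sq M, h2, eval_pow, eval_X] at h1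
  exact_mod_cast h1

/-- Lower bound for the action. -/
lemma loop_action (V₁ V₂ : ℝ[X]) (c C : ℝ)
    (hconf : ∀ x y : ℝ, c * (x ^ 2 + y ^ 2) - C ≤ V₁.eval x + V₂.eval y - x * y)
    (M₁ M₂ : Matrix (Fin N) (Fin N) ℂ) (h₁ : M₁.IsHermitian) (h₂ : M₂.IsHermitian) :
    ∃ r : ℝ, (aeval M₁ V₁ + aeval M₂ V₂ - M₁ * M₂).trace = (r : ℂ) ∧
      c * (‖M₁‖ ^ 2 + ‖M₂‖ ^ 2) - C * N ≤ r := by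
  obtain ⟨U, a, hU, hU', e₁⟩ := loop_spec M₁ h₁
  obtain ⟨V, b, hV, hV', e₂⟩ := loop_spec M₂ h₂
  set W := Uᴴ * V with hW
  have hW1 : W * Wᴴ = 1 := by
    rw [hW, Matrix.conjTranspose_mul, Matrix.conjTranspose_conjTranspose, Matrix.mul_assoc,
      ← Matrix.mul_assoc V, hV', Matrix.one_mul, hU]
  have hW2 : Wᴴ * W = 1 := by
    rw [hW, Matrix.conjTranspose_mul, Matrix.conjTranspose_conjTranspose, Matrix.mul_assoc,
      ← Matrix.mul_assoc U, hU', Matrix.one_mul, hV]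
  have hr := loop_row W hW1
  have hc : ∀ j, ∑ i, ‖W i j‖ ^ 2 = 1 := by
    intro j
    have := loop_row Wᴴ (by rw [Matrix.conjTranspose_conjTranspose, hW2]) j
    simpa using this
  have hM : (M₁ * M₂).trace = ((∑ i, ∑ j, ‖W i j‖ ^ 2 * (a i * b j) : ℝ) : ℂ) := by
    have : (M₁ * M₂).trace = (diagonal (fun i => (a i : ℂ)) * (W *
        (diagonal (fun i => (b i : ℂ)) * Wᴴ))).trace := by
      rw [e₁, e₂, hW, Matrix.conjTranspose_mul,
        Matrix.conjTranspose_conjTranspose]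
      simp only [Matrix.mul_assoc]
      rw [Matrix.trace_mul_comm]
      simp only [Matrix.mul_assoc]
    rw [this]
    simp only [Matrix.trace, Matrix.diag_apply, Matrix.diagonal_mul]
    simp only [Matrix.mul_apply (M := W)]
    simp only [Matrix.diagonal_mul, Matrix.conjTranspose_apply, RCLike.star_def]
    push_cast
    refine Finset.sum_congr rfl fun i _ => ?_
    rw [Finset.mul_sum]
    refine Finset.sum_congr rfl fun j _ => ?_
    have := Complex.mul_conj (W i j)
    rw [Complex.normSq_eq_norm_sq] at this
    push_cast at this
    rw [← this]; ring
  refine ⟨∑ i, V₁.eval (a i) + ∑ j, V₂.eval (b j) - ∑ i, ∑ j, ‖W i j‖ ^ 2 * (a i * b j), ?_, ?_⟩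
  · rw [Matrix.trace_sub, Matrix.trace_add, hM]
    conv_lhs => rw [e₁, e₂]
    rw [loop_trace_aeval _ _ hU hU', loop_trace_aeval _ _ hV hV']
    push_cast; rfl
  · rw [loop_norm_herm U a hU hU' M₁ h₁ e₁, loop_norm_herm V b hV hV' M₂ h₂ e₂]
    have rowsum : ∀ f : Fin N → ℝ, ∑ i, f i = ∑ i, ∑ j, ‖W i j‖ ^ 2 * f i := by
      intro f
      refine Finset.sum_congr rfl fun i _ => ?_
      rw [← Finset.sum_mul, hr, one_mul]
    have colsum : ∀ f : Fin N → ℝ, ∑ j, f j = ∑ i, ∑ j, ‖W i j‖ ^ 2 * f j := by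
      intro f
      rw [Finset.sum_comm]
      refine Finset.sum_congr rfl fun i _ => ?_
      rw [← Finset.sum_mul, hc, one_mul]
    have hN : (N : ℝ) = ∑ i : Fin N, (1 : ℝ) := by simp
    rw [hN, rowsum (fun i => a i ^ 2), colsum (fun i => b i ^ 2), rowsum (fun i => V₁.eval (a i)),
      colsum (fun i => V₂.eval (b i)), rowsum (fun _ => 1)]
    simp only [← Finset.sum_add_distrib, ← Finset.sum_sub_distrib, Finset.mul_sum]
    refine Finset.sum_le_sum fun i _ => Finset.sum_le_sum fun j _ => ?_
    have := mul_le_mul_of_nonneg_left (hconf (a i) (b j)) (sq_nonneg ‖W i j‖)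
    nlinarith [this]

lemma loop_resolvent (x : ℂ) (hx : x.im ≠ 0) : ∃ K : ℝ, 
    ∀ M : Matrix (Fin N) (Fin N) ℂ, M.IsHermitian →
      (x • (1 : Matrix (Fin N) (Fin N) ℂ) - M) * (x • (1 : Matrix (Fin N) (Fin N) ℂ) - M)⁻¹ = 1 ∧
      (x • (1 : Matrix (Fin N) (Fin N) ℂ) - M)⁻¹ * (x • (1 : Matrix (Fin N) (Fin N) ℂ) - M) = 1 ∧
      ‖(x • (1 : Matrix (Fin N) (Fin N) ℂ) - M)⁻¹‖ ≤ K := by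
  refine ⟨√N * (√N * |x.im|⁻¹) * √N, fun M hM => ?_⟩
  obtain ⟨U, a, hU, hU', e⟩ := loop_spec M hM
  have hne : ∀ i, x - (a i : ℂ) ≠ 0 := by
    intro i h
    have := congrArg Complex.im h
    simp at this
    exact hx this
  have hle : ∀ i, |x.im| ≤ ‖x - (a i : ℂ)‖ := by
    intro i
    simpa using Complex.abs_im_le_norm (x - (a i : ℂ))
  set R := U * diagonal (fun i => (x - (a i : ℂ))⁻¹) * Uᴴ with hR
  have e2 : x • (1 : Matrix (Fin N) (Fin N) ℂ) - M = U * diagonal (fun i => x - (a i : ℂ)) * Uᴴ := by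
    rw [e, ← Matrix.diagonal_sub, Matrix.mul_sub, Matrix.sub_mul]
    congr 1
    rw [← Matrix.smul_one_eq_diagonal, Matrix.mul_smul, Matrix.smul_mul, Matrix.mul_one, hU']
  have hmul : (x • (1 : Matrix (Fin N) (Fin N) ℂ) - M) * R = 1 := by
    rw [e2, hR]
    calc _ = U * (diagonal (fun i => x - (a i : ℂ)) * (Uᴴ * U) *
          diagonal (fun i => (x - (a i : ℂ))⁻¹)) * Uᴴ := by simp only [Matrix.mul_assoc]
      _ = 1 := by
        rw [hU, Matrix.mul_one, Matrix.diagonal_mul_diagonal]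
        simp [hne, hU']
  have hinv := Matrix.inv_eq_right_inv hmul
  rw [hinv]
  refine ⟨hmul, mul_eq_one_comm.mp hmul, ?_⟩
  have nU : ‖U‖ = √N := by
    rw [← Real.sqrt_sq (norm_nonneg U), loop_frob_sq]
    simp [loop_row U hU']
  have nU' : ‖Uᴴ‖ = √N := by rw [Matrix.frobenius_norm_conjTranspose, nU]
  have nD : ‖diagonal (fun i => (x - (a i : ℂ))⁻¹)‖ ≤ √N * |x.im|⁻¹ := by
    rw [Matrix.frobenius_norm_diagonal, EuclideanSpace.norm_eq]
    have : √N * |x.im|⁻¹ = √(N * (|x.im|⁻¹)^2) := by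
      rw [Real.sqrt_mul (by positivity), Real.sqrt_sq (by positivity)]
    rw [this]
    apply Real.sqrt_le_sqrt
    have hN : (N : ℝ) * (|x.im|⁻¹)^2 = ∑ i : Fin N, (|x.im|⁻¹)^2 := by simp
    rw [hN]
    refine Finset.sum_le_sum fun i _ => ?_
    have : 0 < |x.im| := abs_pos.mpr hx
    simp only [norm_inv]
    gcongr
    exact hle i
  calc ‖R‖ ≤ ‖U * diagonal (fun i => (x - (a i : ℂ))⁻¹)‖ * ‖Uᴴ‖ := norm_mul_le _ _
    _ ≤ ‖U‖ * ‖diagonal (fun i => (x - (a i : ℂ))⁻¹)‖ * ‖Uᴴ‖ := by gcongr; exact norm_mul_le _ _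
    _ ≤ _ := by rw [nU, nU']; gcongr

lemma loop_deriv_trace (V : ℝ[X]) (M B : Matrix (Fin N) (Fin N) ℂ) :
    HasDerivAt (fun t : ℝ => (aeval (M + t • B) V).trace) ((aeval M (derivative V) * B).trace) 0 := by
  have hline : HasDerivAt (fun t : ℝ => M + t • B) B 0 := by
    convert! ((hasDerivAt_id (0 : ℝ)).smul_const B).const_add M using 1
    simp
  induction V using Polynomial.induction_on' with
  | add p q hp hq =>
    simp only [map_add, Matrix.trace_add, Matrix.add_mul]
    exact hp.add hq
  | monomial n r =>
    have h1 : HasDerivAt (fun t : ℝ => (M + t • B) ^ n)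
        (∑ i ∈ Finset.range n, M ^ (n.pred - i) * B * M ^ i) 0 := by
      have h0 := hasFDerivAt_pow' (𝕜 := ℝ) n (x := M + (0 : ℝ) • B)
      have := h0.comp_hasDerivAt (0 : ℝ) hline
      convert! this using 1
      simp [mul_assoc]
    have h2 := ((Matrix.traceLinearMap (Fin N) ℝ ℂ).toContinuousLinearMap.hasFDerivAt).comp_hasDerivAt
      (0 : ℝ) (h1.const_smul r)
    simp only [aeval_monomial, derivative_monomial, ← Algebra.smul_def]
    convert! h2 using 1
    have : ∀ i ∈ Finset.range n, (M ^ (n.pred - i) * B * M ^ i).trace = (M ^ (n - 1) * B).trace := by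
      intro i hi
      rw [Matrix.trace_mul_comm, ← Matrix.mul_assoc, ← pow_add]
      congr 3
      have := Finset.mem_range.mp hi
      simp only [Nat.pred_eq_sub_one]
      omega
    change _ = (r • ∑ i ∈ Finset.range n, M ^ (n.pred - i) * B * M ^ i).trace
    rw [Matrix.trace_smul, Matrix.trace_sum, Finset.sum_congr rfl this]
    simp [mul_assoc]

lemma loop_SV (V : ℝ[X]) (z : ℂ) (M : Matrix (Fin N) (Fin N) ℂ) :
    SVmat V z M * (z • (1 : Matrix (Fin N) (Fin N) ℂ) - M) =
      (aeval z (derivative V)) • (1 : Matrix (Fin N) (Fin N) ℂ) - aeval M (derivative V) := by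
  have hc : Commute (z • (1 : Matrix (Fin N) (Fin N) ℂ)) M := (Commute.one_left M).smul_left z
  rw [aeval_eq_sum_range, aeval_eq_sum_range, SVmat, Finset.sum_mul, Finset.sum_smul,
    ← Finset.sum_sub_distrib]
  refine Finset.sum_congr rfl fun k _ => ?_
  have := hc.geom_sum₂_mul k
  simp only [_root_.smul_pow, one_pow, smul_mul_assoc, one_mul] at this
  rw [smul_mul_assoc, this, smul_sub, smul_smul]
  congr 1

lemma loop_deriv_inv (x : ℂ) (hx : x.im ≠ 0) (M B : Matrix (Fin N) (Fin N) ℂ) (hM : M.IsHermitian) :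
    HasDerivAt (fun t : ℝ => (x • (1 : Matrix (Fin N) (Fin N) ℂ) - (M + t • B))⁻¹)
      ((x • (1 : Matrix (Fin N) (Fin N) ℂ) - M)⁻¹ * B * (x • (1 : Matrix (Fin N) (Fin N) ℂ) - M)⁻¹) 0 := by
  have hline : HasDerivAt (fun t : ℝ => x • (1 : Matrix (Fin N) (Fin N) ℂ) - (M + t • B)) (-B) 0 := by
    convert! (((hasDerivAt_id (0 : ℝ)).smul_const B).const_add M).const_sub
      (x • (1 : Matrix (Fin N) (Fin N) ℂ)) using 1
    simp
  obtain ⟨K, hK⟩ := loop_resolvent (N := N) x hx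
  obtain ⟨h1, h2, -⟩ := hK M hM
  simp only [Matrix.nonsing_inv_eq_ringInverse] at h1 h2 ⊢
  set u : (Matrix (Fin N) (Fin N) ℂ)ˣ := ⟨_, _, h1, h2⟩ with hu
  have h0 := hasFDerivAt_ringInverse (𝕜 := ℝ) u
  have e : (u : Matrix (Fin N) (Fin N) ℂ) = x • (1 : Matrix (Fin N) (Fin N) ℂ) - (M + (0 : ℝ) • B) := by
    simp [hu]
  rw [e] at h0
  have := h0.comp_hasDerivAt (0 : ℝ) hline
  convert! this using 1
  simp [hu]

lemma loop_cont_inv (x : ℂ) (hx : x.im ≠ 0) {E : Type*} [TopologicalSpace E]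
    (m : E → Matrix (Fin N) (Fin N) ℂ) (hm : Continuous m) (hh : ∀ p, (m p).IsHermitian) :
    Continuous fun p => (x • (1 : Matrix (Fin N) (Fin N) ℂ) - m p)⁻¹ := by
  obtain ⟨K, hK⟩ := loop_resolvent (N := N) x hx
  simp only [Matrix.nonsing_inv_eq_ringInverse] at hK ⊢
  rw [continuous_iff_continuousAt]
  intro p
  obtain ⟨h1, h2, -⟩ := hK (m p) (hh p)
  set u : (Matrix (Fin N) (Fin N) ℂ)ˣ := ⟨_, _, h1, h2⟩ with hu
  have h0 := NormedRing.inverse_continuousAt u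
  exact ContinuousAt.comp (f := fun p => x • (1 : Matrix (Fin N) (Fin N) ℂ) - m p) h0
    (by fun_prop)

section tame
variable {E : Type*} [NormedAddCommGroup E] {F : Type*} [NormedAddCommGroup F]
  {R : Type*} [NormedRing R]

/-- Continuous functions of at most polynomial growth. -/
def LoopTame (f : E → F) : Prop :=
  Continuous f ∧ ∃ K : ℝ, 0 ≤ K ∧ ∃ m : ℕ, ∀ p, ‖f p‖ ≤ K * (1 + ‖p‖) ^ m

lemma LoopTame.bdd {f : E → F} (hc : Continuous f) (K : ℝ) (h : ∀ p, ‖f p‖ ≤ K) : LoopTame f :=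
  ⟨hc, K, (norm_nonneg _).trans (h 0), 0, by simpa using h⟩

lemma LoopTame.const (a : F) : LoopTame (fun _ : E => a) :=
  LoopTame.bdd continuous_const ‖a‖ fun _ => le_rfl

lemma LoopTame.add {f g : E → F} (hf : LoopTame f) (hg : LoopTame g) :
    LoopTame fun p => f p + g p := by
  obtain ⟨cf, K, hK, m, h⟩ := hf
  obtain ⟨cg, L, hL, n, h'⟩ := hg
  refine ⟨cf.add cg, K + L, by positivity, m + n, fun p => ?_⟩
  have h1 : (1 : ℝ) ≤ 1 + ‖p‖ := by linarith [norm_nonneg p]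
  calc ‖f p + g p‖ ≤ ‖f p‖ + ‖g p‖ := norm_add_le _ _
    _ ≤ K * (1 + ‖p‖) ^ m + L * (1 + ‖p‖) ^ n := add_le_add (h p) (h' p)
    _ ≤ K * (1 + ‖p‖) ^ (m + n) + L * (1 + ‖p‖) ^ (m + n) := by
        gcongr
        · omega
        · omega
    _ = _ := by ring

lemma LoopTame.mul {f g : E → R} (hf : LoopTame f) (hg : LoopTame g) :
    LoopTame fun p => f p * g p := by
  obtain ⟨cf, K, hK, m, h⟩ := hf
  obtain ⟨cg, L, hL, n, h'⟩ := hg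
  refine ⟨cf.mul cg, K * L, by positivity, m + n, fun p => ?_⟩
  calc ‖f p * g p‖ ≤ ‖f p‖ * ‖g p‖ := norm_mul_le _ _
    _ ≤ (K * (1 + ‖p‖) ^ m) * (L * (1 + ‖p‖) ^ n) :=
        mul_le_mul (h p) (h' p) (norm_nonneg _) (by positivity)
    _ = _ := by ring

lemma LoopTame.clm [NormedSpace ℝ F] {G : Type*} [NormedAddCommGroup G] [NormedSpace ℝ G]
    (L : F →L[ℝ] G) {f : E → F} (hf : LoopTame f) : LoopTame fun p => L (f p) := by
  obtain ⟨cf, K, hK, m, h⟩ := hf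
  refine ⟨L.continuous.comp cf, ‖L‖ * K, by positivity, m, fun p => ?_⟩
  calc ‖L (f p)‖ ≤ ‖L‖ * ‖f p‖ := L.le_opNorm _
    _ ≤ ‖L‖ * (K * (1 + ‖p‖) ^ m) := by gcongr; exact h p
    _ = _ := by ring

lemma LoopTame.linear [NormedSpace ℝ E] [NormedSpace ℝ F] (L : E →L[ℝ] F) :
    LoopTame fun p => L p := by
  refine LoopTame.clm L (f := fun p => p) ⟨continuous_id, 1, zero_le_one, 1, fun p => ?_⟩
  simp

lemma LoopTame.neg {f : E → F} (hf : LoopTame f) : LoopTame fun p => - f p := by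
  obtain ⟨cf, K, hK, m, h⟩ := hf
  exact ⟨cf.neg, K, hK, m, by simpa using h⟩

lemma LoopTame.sub {f g : E → F} (hf : LoopTame f) (hg : LoopTame g) :
    LoopTame fun p => f p - g p := by
  simpa [sub_eq_add_neg] using hf.add hg.neg

lemma LoopTame.pow {f : E → R} (hf : LoopTame f) (n : ℕ) : LoopTame fun p => f p ^ n := by
  induction n with
  | zero => simpa using LoopTame.const (1 : R)
  | succ n ih => simpa [pow_succ] using ih.mul hf

lemma LoopTame.sum {ι : Type*} (s : Finset ι) {f : ι → E → F} (hf : ∀ i ∈ s, LoopTame (f i)) :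
    LoopTame fun p => ∑ i ∈ s, f i p := by
  classical
  induction s using Finset.induction_on with
  | empty => simpa using LoopTame.const (0 : F)
  | insert a s ha ih =>
    simp only [Finset.sum_insert ha]
    exact (hf a (by simp)).add (ih fun i hi => hf i (by simp [hi]))

lemma LoopTame.smul [NormedSpace ℂ F] (a : ℂ) {f : E → F} (hf : LoopTame f) :
    LoopTame fun p => a • f p := by
  obtain ⟨cf, K, hK, m, h⟩ := hf
  refine ⟨cf.const_smul a, ‖a‖ * K, by positivity, m, fun p => ?_⟩
  rw [norm_smul, mul_assoc]
  gcongr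
  exact h p

lemma LoopTame.aeval {f : E → Matrix (Fin N) (Fin N) ℂ} (hf : LoopTame f) (V : ℝ[X]) :
    LoopTame fun p => aeval (f p) V := by
  simp only [aeval_eq_sum_range]
  refine LoopTame.sum _ fun i _ => ?_
  simpa using (hf.pow i).smul (V.coeff i : ℂ)

lemma LoopTame.SV {f : E → Matrix (Fin N) (Fin N) ℂ} (hf : LoopTame f) (V : ℝ[X]) (z : ℂ) :
    LoopTame fun p => SVmat V z (f p) := by
  unfold SVmat
  exact LoopTame.sum _ fun i _ => (LoopTame.sum _ fun j _ => (hf.pow _).smul _).smul _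

lemma LoopTame.trace {f : E → Matrix (Fin N) (Fin N) ℂ} (hf : LoopTame f) :
    LoopTame fun p => (f p).trace :=
  hf.clm (Matrix.traceLinearMap (Fin N) ℝ ℂ).toContinuousLinearMap

lemma LoopTame.entry {f : E → Matrix (Fin N) (Fin N) ℂ} (hf : LoopTame f) (i j : Fin N) :
    LoopTame fun p => f p i j :=
  hf.clm (Matrix.entryLinearMap ℝ ℂ i j).toContinuousLinearMap

end tame
section core
variable {E : Type*} [NormedAddCommGroup E] [NormedSpace ℝ E] [FiniteDimensional ℝ E]
  [MeasurableSpace E] [BorelSpace E] (ν : Measure E) [ν.IsAddHaarMeasure]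

/-- The data over which the abstract argument is carried out. -/
structure LoopData (N : ℕ) (T : ℝ) (V₁ V₂ : ℝ[X])
    (m₁ m₂ : E →L[ℝ] Matrix (Fin N) (Fin N) ℂ) : Prop where
  hN : 1 ≤ N
  hT : 0 < T
  hconf : ∃ c > (0 : ℝ), ∃ C : ℝ, ∀ x y : ℝ,
      c * (x ^ 2 + y ^ 2) - C ≤ V₁.eval x + V₂.eval y - x * y
  h₁ : ∀ p, (m₁ p).IsHermitian
  h₂ : ∀ p, (m₂ p).IsHermitian
  norm_le : ∀ p, ‖p‖ ≤ ‖m₁ p‖ + ‖m₂ p‖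
  surj : ∀ B C : Matrix (Fin N) (Fin N) ℂ, B.IsHermitian → C.IsHermitian → ∃ v, m₁ v = B ∧ m₂ v = C

variable {T : ℝ} {V₁ V₂ : ℝ[X]} {m₁ m₂ : E →L[ℝ] Matrix (Fin N) (Fin N) ℂ}

lemma LoopData.weight_bound (d : LoopData N T V₁ V₂ m₁ m₂) :
    ∃ b > (0 : ℝ), ∃ D : ℝ, ∀ p, ‖hweight N T V₁ V₂ (m₁ p) (m₂ p)‖ ≤
      Real.exp (D - b * ‖p‖ ^ 2) := by
  obtain ⟨c, hc, C, hC⟩ := d.hconf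
  have hT := d.hT
  have hN : (0 : ℝ) < N := by exact_mod_cast d.hN
  refine ⟨N / T * c / 2, by positivity, N / T * (C * N), fun p => ?_⟩
  obtain ⟨r, hr, hle⟩ := loop_action V₁ V₂ c C hC (m₁ p) (m₂ p) (d.h₁ p) (d.h₂ p)
  rw [hweight, hr, Complex.norm_exp]
  apply Real.exp_le_exp.mpr
  have e : (-((N : ℂ) / (T : ℂ)) * (r : ℂ)).re = -(N / T * r) := by
    rw [← Complex.ofReal_natCast, ← Complex.ofReal_div, ← Complex.ofReal_neg, ← Complex.ofReal_mul,
      Complex.ofReal_re]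
    ring
  rw [e]
  have h1 := d.norm_le p
  have h2 : ‖p‖ ^ 2 ≤ 2 * (‖m₁ p‖ ^ 2 + ‖m₂ p‖ ^ 2) := by
    nlinarith [norm_nonneg p, sq_nonneg (‖m₁ p‖ - ‖m₂ p‖)]
  have h3 : c / 2 * ‖p‖ ^ 2 - C * N ≤ r := by nlinarith
  have h4 : N / T * (c / 2 * ‖p‖ ^ 2 - C * N) ≤ N / T * r := by gcongr
  nlinarith

lemma loop_weight_cont (V₁ V₂ : ℝ[X]) (m₁ m₂ : E →L[ℝ] Matrix (Fin N) (Fin N) ℂ) :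
    Continuous fun p => hweight N T V₁ V₂ (m₁ p) (m₂ p) := by
  unfold hweight
  have h1 := LoopTame.linear m₁
  have h2 := LoopTame.linear m₂
  exact Complex.continuous_exp.comp (continuous_const.mul
    (((h1.aeval V₁).add (h2.aeval V₂)).sub (h1.mul h2)).trace.1)

lemma LoopData.integrable (d : LoopData N T V₁ V₂ m₁ m₂) {f : E → ℂ} (hf : LoopTame f) :
    Integrable (fun p => f p * hweight N T V₁ V₂ (m₁ p) (m₂ p)) ν := by
  obtain ⟨b, hb, D, hD⟩ := d.weight_bound
  obtain ⟨cf, K, hK, m, h⟩ := hf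
  set n := Module.finrank ℝ E + 1 with hn
  have hbase : Integrable (fun p : E => (1 + ‖p‖) ^ (-(n : ℝ))) ν :=
    integrable_one_add_norm (by rw [hn]; push_cast; linarith)
  set k := m + n with hk
  refine (hbase.const_mul (K * Real.exp D * ((2 / b) ^ k * (k.factorial : ℝ) * Real.exp b))).mono'
    (cf.mul (loop_weight_cont V₁ V₂ m₁ m₂)).aestronglyMeasurable (Filter.Eventually.of_forall fun p => ?_)
  have key : (1 + ‖p‖) ^ k ≤ (2 / b) ^ k * (k.factorial : ℝ) * Real.exp b * Real.exp (b * ‖p‖ ^ 2) := by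
    have h1 := Real.pow_div_factorial_le_exp (x := b * (1 + ‖p‖ ^ 2)) (by positivity) k
    rw [div_le_iff₀ (by positivity)] at h1
    have h2 : 1 + ‖p‖ ≤ 2 / b * (b * (1 + ‖p‖ ^ 2)) := by
      field_simp
      nlinarith [sq_nonneg (‖p‖ - 1)]
    calc (1 + ‖p‖) ^ k ≤ (2 / b * (b * (1 + ‖p‖ ^ 2))) ^ k := by gcongr
      _ = (2 / b) ^ k * (b * (1 + ‖p‖ ^ 2)) ^ k := mul_pow _ _ _
      _ ≤ (2 / b) ^ k * (Real.exp (b * (1 + ‖p‖ ^ 2)) * k.factorial) := by gcongr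
      _ = _ := by rw [mul_add, Real.exp_add, mul_one]; ring
  have hpos : 0 < 1 + ‖p‖ := by positivity
  rw [Real.rpow_neg hpos.le, Real.rpow_natCast, norm_mul, ← div_eq_mul_inv, le_div_iff₀ (by positivity)]
  calc ‖f p‖ * ‖hweight N T V₁ V₂ (m₁ p) (m₂ p)‖ * (1 + ‖p‖) ^ n
      ≤ (K * (1 + ‖p‖) ^ m) * Real.exp (D - b * ‖p‖ ^ 2) * (1 + ‖p‖) ^ n := by
        gcongr
        · exact h p
        · exact hD p
    _ = K * Real.exp (D - b * ‖p‖ ^ 2) * (1 + ‖p‖) ^ k := by rw [hk, pow_add]; ring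
    _ ≤ K * Real.exp (D - b * ‖p‖ ^ 2) * ((2 / b) ^ k * (k.factorial : ℝ) * Real.exp b *
          Real.exp (b * ‖p‖ ^ 2)) := by gcongr
    _ = _ := by
      rw [sub_eq_add_neg, Real.exp_add, Real.exp_neg]
      field_simp

lemma LoopData.Z_ne (d : LoopData N T V₁ V₂ m₁ m₂) :
    ∫ p, hweight N T V₁ V₂ (m₁ p) (m₂ p) ∂ν ≠ 0 := by
  obtain ⟨c, hc, C, hC⟩ := d.hconf
  have hr : ∀ p, ∃ r : ℝ, hweight N T V₁ V₂ (m₁ p) (m₂ p) = (Real.exp r : ℂ) := by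
    intro p
    obtain ⟨r, hr, -⟩ := loop_action V₁ V₂ c C hC (m₁ p) (m₂ p) (d.h₁ p) (d.h₂ p)
    refine ⟨-(N / T) * r, ?_⟩
    rw [hweight, hr]
    push_cast
    rfl
  choose r hr using hr
  have hi := d.integrable ν (LoopTame.const (1 : ℂ))
  simp only [one_mul, hr] at hi ⊢
  have hi' : Integrable (fun p => Real.exp (r p)) ν := by
    have h0 := hi.re
    exact h0
  have h1 : ∫ p, ((Real.exp (r p) : ℝ) : ℂ) ∂ν = ((∫ p, Real.exp (r p) ∂ν : ℝ) : ℂ) :=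
    integral_ofReal
  rw [h1]
  have := integral_exp_pos hi'
  exact_mod_cast this.ne'

lemma loop_weight_deriv (V₁ V₂ : ℝ[X]) (m₁ m₂ : E →L[ℝ] Matrix (Fin N) (Fin N) ℂ) (p v : E) :
    HasLineDerivAt ℝ (fun p => hweight N T V₁ V₂ (m₁ p) (m₂ p))
      (-((N : ℂ) / (T : ℂ)) * (((aeval (m₁ p) (derivative V₁) - m₂ p) * m₁ v).trace +
        ((aeval (m₂ p) (derivative V₂) - m₁ p) * m₂ v).trace) *
        hweight N T V₁ V₂ (m₁ p) (m₂ p)) p v := by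
  unfold HasLineDerivAt hweight
  simp only [map_add, map_smul]
  have a1 := loop_deriv_trace V₁ (m₁ p) (m₁ v)
  have a2 := loop_deriv_trace V₂ (m₂ p) (m₂ v)
  have hline : ∀ M B : Matrix (Fin N) (Fin N) ℂ, HasDerivAt (fun t : ℝ => M + t • B) B 0 := by
    intro M B
    convert! ((hasDerivAt_id (0 : ℝ)).smul_const B).const_add M using 1
    simp
  have a3 : HasDerivAt (fun t : ℝ => ((m₁ p + t • m₁ v) * (m₂ p + t • m₂ v)).trace)
      ((m₁ v * m₂ p).trace + (m₁ p * m₂ v).trace) 0 := by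
    have h0 := (hline (m₁ p) (m₁ v)).mul (hline (m₂ p) (m₂ v))
    have := ((Matrix.traceLinearMap (Fin N) ℝ ℂ).toContinuousLinearMap.hasFDerivAt).comp_hasDerivAt
      (0 : ℝ) h0
    convert! this using 1
    change _ = Matrix.trace (m₁ v * (m₂ p + (0 : ℝ) • m₂ v) + (m₁ p + (0 : ℝ) • m₁ v) * m₂ v)
    simp
  have := (((a1.add a2).sub a3).const_mul (-((N : ℂ) / (T : ℂ)))).cexp
  simp only [Matrix.trace_sub, Matrix.trace_add]
  convert! this using 1
  simp only [Matrix.sub_mul, Matrix.trace_sub, zero_smul, add_zero, Pi.add_apply, Pi.sub_apply]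
  rw [Matrix.trace_mul_comm (m₁ v) (m₂ p)]
  ring

lemma LoopData.ibp (d : LoopData N T V₁ V₂ m₁ m₂) {f f' : E → ℂ} (hf : LoopTame f)
    (hf' : LoopTame f') (v : E) (h : ∀ p, HasLineDerivAt ℝ f (f' p) p v) :
    ∫ p, (f' p - (N : ℂ) / (T : ℂ) * (f p * (((aeval (m₁ p) (derivative V₁) - m₂ p) * m₁ v).trace +
        ((aeval (m₂ p) (derivative V₂) - m₁ p) * m₂ v).trace))) *
        hweight N T V₁ V₂ (m₁ p) (m₂ p) ∂ν = 0 := by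
  have h1 := LoopTame.linear m₁
  have h2 := LoopTame.linear m₂
  have hL : LoopTame fun p => -((N : ℂ) / (T : ℂ)) * (((aeval (m₁ p) (derivative V₁) - m₂ p) * m₁ v).trace +
        ((aeval (m₂ p) (derivative V₂) - m₁ p) * m₂ v).trace) :=
    (LoopTame.const _).mul (((((h1.aeval _).sub h2).mul (LoopTame.const _)).trace).add
      ((((h2.aeval _).sub h1).mul (LoopTame.const _)).trace))
  have i1 := d.integrable ν hf'
  have i2 := d.integrable ν (hf.mul hL)
  simp only [mul_assoc (f _)] at i2
  have i3 := d.integrable ν hf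
  have := integral_bilinear_hasLineDerivAt_right_eq_neg_left_of_integrable (μ := ν) (v := v)
    (f := f) (f' := f') (g := fun p => hweight N T V₁ V₂ (m₁ p) (m₂ p))
    (B := ContinuousLinearMap.mul ℝ ℂ) i1 i2 i3 (fun p _ => h p)
    (fun p _ => loop_weight_deriv V₁ V₂ m₁ m₂ p v)
  simp only [ContinuousLinearMap.mul_apply'] at this
  have h0 := integral_add i1 i2
  rw [this, add_neg_cancel] at h0
  rw [← h0]
  congr 1
  ext p
  ring

lemma loop_trace_single (X : Matrix (Fin N) (Fin N) ℂ) (i j : Fin N) :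
    (X * Matrix.single i j (1 : ℂ)).trace = X j i := by
  rw [Matrix.trace_mul_comm, Matrix.trace_single_mul]
  simp

/-- The abstract loop equation. -/
lemma LoopData.loop (d : LoopData N T V₁ V₂ m₁ m₂) {F X : E → Matrix (Fin N) (Fin N) ℂ}
    (D : E → Matrix (Fin N) (Fin N) ℂ →ₗ[ℂ] Matrix (Fin N) (Fin N) ℂ)
    (hF : LoopTame F) (hX : LoopTame X) (hD : ∀ B, LoopTame fun p => D p B)
    (h : ∀ B : Matrix (Fin N) (Fin N) ℂ, B.IsHermitian → ∃ v, (∀ p,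
      HasDerivAt (fun t : ℝ => F (p + t • v)) (D p B) 0) ∧
      ∀ p, ((aeval (m₁ p) (derivative V₁) - m₂ p) * m₁ v).trace +
        ((aeval (m₂ p) (derivative V₂) - m₁ p) * m₂ v).trace = (X p * B).trace) :
    ∫ p, (∑ i, ∑ j, D p (Matrix.single i j 1) i j - (N : ℂ) / (T : ℂ) * (F p * X p).trace) *
        hweight N T V₁ V₂ (m₁ p) (m₂ p) ∂ν = 0 := by
  set G : Fin N → Fin N → Matrix (Fin N) (Fin N) ℂ → E → ℂ := fun i j B p =>
    (D p B i j - (N : ℂ) / (T : ℂ) * (F p i j * (X p * B).trace)) with hG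
  have tG : ∀ i j B, LoopTame (G i j B) := fun i j B =>
    ((hD B).entry i j).sub ((LoopTame.const _).mul ((hF.entry i j).mul
      (hX.mul (LoopTame.const B)).trace))
  have hherm : ∀ i j B, B.IsHermitian →
      ∫ p, G i j B p * hweight N T V₁ V₂ (m₁ p) (m₂ p) ∂ν = 0 := by
    intro i j B hB
    obtain ⟨v, hv, hv'⟩ := h B hB
    have := d.ibp ν (hF.entry i j) ((hD B).entry i j) v (fun p =>
      ((Matrix.entryLinearMap ℝ ℂ i j).toContinuousLinearMap.hasFDerivAt).comp_hasDerivAt (0 : ℝ) (hv p))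
    simpa only [hv'] using this
  have hall : ∀ i j B, ∫ p, G i j B p * hweight N T V₁ V₂ (m₁ p) (m₂ p) ∂ν = 0 := by
    intro i j B
    set B1 : Matrix (Fin N) (Fin N) ℂ := (realPart B : Matrix (Fin N) (Fin N) ℂ) with hB1
    set B2 : Matrix (Fin N) (Fin N) ℂ := (imaginaryPart B : Matrix (Fin N) (Fin N) ℂ) with hB2
    have e : B = B1 + Complex.I • B2 := (realPart_add_I_smul_imaginaryPart B).symm
    have e2 : ∀ p, G i j B p * hweight N T V₁ V₂ (m₁ p) (m₂ p) =
        G i j B1 p * hweight N T V₁ V₂ (m₁ p) (m₂ p) +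
        Complex.I * (G i j B2 p * hweight N T V₁ V₂ (m₁ p) (m₂ p)) := by
      intro p
      simp only [hG]
      rw [e]
      simp only [map_add, map_smul, Matrix.add_apply, Matrix.smul_apply, Matrix.mul_add,
        Matrix.mul_smul, Matrix.trace_add, Matrix.trace_smul, smul_eq_mul]
      ring
    simp only [e2]
    rw [integral_add (d.integrable ν (tG i j B1)) ((d.integrable ν (tG i j B2)).const_mul _),
      integral_const_mul, hherm i j B1 (realPart B).2, hherm i j B2 (imaginaryPart B).2]
    simp
  have hsum : ∀ p, (∑ i, ∑ j, D p (Matrix.single i j 1) i j - (N : ℂ) / (T : ℂ) * (F p * X p).trace) *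
        hweight N T V₁ V₂ (m₁ p) (m₂ p) =
      ∑ i, ∑ j, G i j (Matrix.single i j 1) p * hweight N T V₁ V₂ (m₁ p) (m₂ p) := by
    intro p
    simp only [hG, loop_trace_single, ← Finset.sum_mul, Finset.sum_sub_distrib, ← Finset.mul_sum]
    simp only [Matrix.trace, Matrix.diag_apply, Matrix.mul_apply]
  simp only [hsum]
  rw [integral_finsetSum _ fun i _ => integrable_finsetSum _ fun j _ => d.integrable ν (tG i j _)]
  refine Finset.sum_eq_zero fun i _ => ?_
  rw [integral_finsetSum _ fun j _ => d.integrable ν (tG i j _)]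
  exact Finset.sum_eq_zero fun j _ => hall i j _

lemma loop_lin (a b c n : ℂ) {f1 f2 f3 f4 f5 : E → ℂ} (h1 : Integrable f1 ν) (h2 : Integrable f2 ν)
    (h3 : Integrable f3 ν) (h4 : Integrable f4 ν) (h5 : Integrable f5 ν) :
    ∫ p, (f1 p - a * (b * f2 p - f3 p + c * f4 p + n * f5 p)) ∂ν =
      ∫ p, f1 p ∂ν - a * (b * ∫ p, f2 p ∂ν - ∫ p, f3 p ∂ν + c * ∫ p, f4 p ∂ν + n * ∫ p, f5 p ∂ν) := by
  have k2 : Integrable (fun p => b * f2 p) ν := h2.const_mul _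
  have k3 : Integrable (fun p => b * f2 p - f3 p) ν := k2.sub h3
  have k4 : Integrable (fun p => c * f4 p) ν := h4.const_mul _
  have k5 : Integrable (fun p => b * f2 p - f3 p + c * f4 p) ν := k3.add k4
  have k6 : Integrable (fun p => n * f5 p) ν := h5.const_mul _
  have k7 : Integrable (fun p => b * f2 p - f3 p + c * f4 p + n * f5 p) ν := k5.add k6
  have k8 : Integrable (fun p => a * (b * f2 p - f3 p + c * f4 p + n * f5 p)) ν := k7.const_mul _
  rw [integral_sub h1 k8, integral_const_mul, integral_add k5 k6, integral_add k3 k4,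
    integral_sub k2 h3, integral_const_mul, integral_const_mul, integral_const_mul]

lemma loop_sum_single (A Q : Matrix (Fin N) (Fin N) ℂ) :
    ∑ i, ∑ j, (A * Matrix.single i j (1 : ℂ) * Q : Matrix (Fin N) (Fin N) ℂ) i j = A.trace * Q.trace := by
  have : ∀ i j, (A * Matrix.single i j (1 : ℂ) * Q : Matrix (Fin N) (Fin N) ℂ) i j = A i i * Q j j := by
    intro i j
    rw [Matrix.mul_assoc, Matrix.mul_apply, Finset.sum_eq_single i]
    · simp
    · intro k _ hk
      rw [Matrix.single_mul_apply_of_ne _ _ _ _ _ hk, mul_zero]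
    · simp
  simp only [this, Matrix.trace, Matrix.diag_apply, Finset.sum_mul_sum]

lemma LoopData.core (d : LoopData N T V₁ V₂ m₁ m₂) (x y : ℂ) (hx : x.im ≠ 0) :
    ∫ p, ((x • (1 : Matrix (Fin N) (Fin N) ℂ) - m₁ p)⁻¹ * SVmat V₂ y (m₂ p)).trace *
      ((x • (1 : Matrix (Fin N) (Fin N) ℂ) - m₁ p)⁻¹).trace * hweight N T V₁ V₂ (m₁ p) (m₂ p) ∂ν =
    (N : ℂ) / (T : ℂ) * ((aeval x (derivative V₁) - y) *
      ∫ p, ((x • (1 : Matrix (Fin N) (Fin N) ℂ) - m₁ p)⁻¹ * SVmat V₂ y (m₂ p)).trace *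
        hweight N T V₁ V₂ (m₁ p) (m₂ p) ∂ν
      - ∫ p, (SVmat V₁ x (m₁ p) * SVmat V₂ y (m₂ p)).trace *
        hweight N T V₁ V₂ (m₁ p) (m₂ p) ∂ν
      + (aeval y (derivative V₂) - x) *
        ∫ p, ((x • (1 : Matrix (Fin N) (Fin N) ℂ) - m₁ p)⁻¹).trace *
          hweight N T V₁ V₂ (m₁ p) (m₂ p) ∂ν
      + N * ∫ p, hweight N T V₁ V₂ (m₁ p) (m₂ p) ∂ν) := by
  have h1 := LoopTame.linear m₁
  have h2 := LoopTame.linear m₂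
  obtain ⟨K, hK⟩ := loop_resolvent (N := N) x hx
  set A : E → Matrix (Fin N) (Fin N) ℂ := fun p => (x • (1 : Matrix (Fin N) (Fin N) ℂ) - m₁ p)⁻¹ with hA
  set S : E → Matrix (Fin N) (Fin N) ℂ := fun p => SVmat V₂ y (m₂ p) with hS
  have tA : LoopTame A := LoopTame.bdd (loop_cont_inv x hx m₁ m₁.continuous d.h₁) K
    fun p => (hK _ (d.h₁ p)).2.2
  have tS : LoopTame S := h2.SV V₂ y
  have t1 : LoopTame fun p => aeval (m₁ p) (derivative V₁) - m₂ p := (h1.aeval _).sub h2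
  have t2 : LoopTame fun p => aeval (m₂ p) (derivative V₂) - m₁ p := (h2.aeval _).sub h1
  have t3 : LoopTame fun p => SVmat V₁ x (m₁ p) := h1.SV V₁ x
  have I1 := d.loop ν (F := fun p => A p * S p) (X := fun p => aeval (m₁ p) (derivative V₁) - m₂ p)
    (fun p => (LinearMap.mulRight ℂ (A p * S p)).comp (LinearMap.mulLeft ℂ (A p)))
    (tA.mul tS) t1 (fun B => (tA.mul (LoopTame.const B)).mul (tA.mul tS)) (by
      intro B hB
      obtain ⟨v, e1, e2⟩ := d.surj B 0 hB Matrix.isHermitian_zero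
      refine ⟨v, fun p => ?_, fun p => by simp [e1, e2]⟩
      have := (loop_deriv_inv x hx (m₁ p) B (d.h₁ p)).mul_const (S p)
      simp only [hA, hS, map_add, map_smul, e1, e2, smul_zero, add_zero]
      convert! this using 1
      simp [hA, hS, Matrix.mul_assoc])
  have I2 := d.loop ν (F := A) (X := fun p => aeval (m₂ p) (derivative V₂) - m₁ p)
    (fun p => 0) tA t2 (fun B => LoopTame.const 0) (by
      intro B hB
      obtain ⟨v, e1, e2⟩ := d.surj 0 B Matrix.isHermitian_zero hB
      refine ⟨v, fun p => ?_, fun p => by simp [e1, e2]⟩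
      simp only [hA, map_add, map_smul, e1, smul_zero, add_zero]
      exact hasDerivAt_const _ _)
  simp only [LinearMap.comp_apply, LinearMap.mulRight_apply, LinearMap.mulLeft_apply,
    loop_sum_single] at I1
  simp only [LinearMap.zero_apply, Matrix.zero_apply, Finset.sum_const_zero] at I2
  have i1 := d.integrable ν ((tA.trace.mul (tA.mul tS).trace).sub
    ((LoopTame.const ((N : ℂ) / (T : ℂ))).mul ((tA.mul tS).mul t1).trace))
  have i2 := d.integrable ν ((LoopTame.const (0 : ℂ)).sub
    ((LoopTame.const ((N : ℂ) / (T : ℂ))).mul (tA.mul t2).trace))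
  have I12 := integral_add i1 i2
  rw [I1, I2, add_zero] at I12
  have j1 := d.integrable ν ((tA.mul tS).trace.mul tA.trace)
  have j2 := d.integrable ν (tA.mul tS).trace
  have j3 := d.integrable ν (t3.mul tS).trace
  have j4 := d.integrable ν tA.trace
  have j5 := d.integrable ν (LoopTame.const (1 : ℂ))
  simp only [one_mul] at j5
  have pt : ∀ p, (((A p).trace * (A p * S p).trace - (N : ℂ) / (T : ℂ) *
        (A p * S p * (aeval (m₁ p) (derivative V₁) - m₂ p)).trace) *
          hweight N T V₁ V₂ (m₁ p) (m₂ p) +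
      (0 - (N : ℂ) / (T : ℂ) * (A p * (aeval (m₂ p) (derivative V₂) - m₁ p)).trace) *
          hweight N T V₁ V₂ (m₁ p) (m₂ p)) =
      (A p * S p).trace * (A p).trace * hweight N T V₁ V₂ (m₁ p) (m₂ p) -
      (N : ℂ) / (T : ℂ) * ((aeval x (derivative V₁) - y) *
        ((A p * S p).trace * hweight N T V₁ V₂ (m₁ p) (m₂ p))
      - (SVmat V₁ x (m₁ p) * S p).trace * hweight N T V₁ V₂ (m₁ p) (m₂ p)
      + (aeval y (derivative V₂) - x) * ((A p).trace * hweight N T V₁ V₂ (m₁ p) (m₂ p))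
      + N * hweight N T V₁ V₂ (m₁ p) (m₂ p)) := by
    intro p
    obtain ⟨r1, r2, -⟩ := hK _ (d.h₁ p)
    change _ * A p = 1 at r1
    change A p * _ = 1 at r2
    have s1 := loop_SV V₁ x (m₁ p)
    have s2 : S p * _ = _ := loop_SV V₂ y (m₂ p)
    have q1 : aeval (m₁ p) (derivative V₁) * A p =
        aeval x (derivative V₁) • A p - SVmat V₁ x (m₁ p) := by
      have := congrArg (· * A p) s1
      simp only [Matrix.mul_assoc, r1, Matrix.mul_one, Matrix.sub_mul, Matrix.smul_mul,
        Matrix.one_mul] at this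
      rw [this]; abel
    have q2 : S p * m₂ p = y • S p - (aeval y (derivative V₂)) • (1 : Matrix (Fin N) (Fin N) ℂ)
        + aeval (m₂ p) (derivative V₂) := by
      rw [Matrix.mul_sub, Matrix.mul_smul, Matrix.mul_one] at s2
      rw [sub_add, ← s2]; abel
    have q3 : A p * m₁ p = x • A p - 1 := by
      rw [Matrix.mul_sub, Matrix.mul_smul, Matrix.mul_one] at r2
      rw [← r2]; abel
    have u1 : (A p * S p * (aeval (m₁ p) (derivative V₁) - m₂ p)).trace =
        aeval x (derivative V₁) * (A p * S p).trace - (SVmat V₁ x (m₁ p) * S p).trace -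
        (y * (A p * S p).trace - aeval y (derivative V₂) * (A p).trace +
          (A p * aeval (m₂ p) (derivative V₂)).trace) := by
      rw [Matrix.mul_sub, Matrix.trace_sub, Matrix.trace_mul_comm, ← Matrix.mul_assoc, q1,
        Matrix.mul_assoc (A p) (S p) (m₂ p), q2]
      simp only [Matrix.sub_mul, Matrix.mul_sub, Matrix.mul_add, Matrix.smul_mul, Matrix.mul_smul,
        Matrix.mul_one, Matrix.trace_sub, Matrix.trace_add, Matrix.trace_smul, smul_eq_mul]
    have u2 : (A p * (aeval (m₂ p) (derivative V₂) - m₁ p)).trace =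
        (A p * aeval (m₂ p) (derivative V₂)).trace - (x * (A p).trace - N) := by
      rw [Matrix.mul_sub, q3]
      simp [Matrix.trace_sub]
    rw [u1, u2]
    ring
  simp only [pt] at I12
  rw [loop_lin ν _ _ _ _ j1 j2 j3 j4 j5] at I12
  exact sub_eq_zero.mp I12

end core
lemma loop_prod {H : Type} [NormedAddCommGroup H] [NormedSpace ℝ H] [FiniteDimensional ℝ H]
    [MeasurableSpace H] [BorelSpace H] (μ : Measure H) [μ.IsAddHaarMeasure]
    (ι : H →L[ℝ] Matrix (Fin N) (Fin N) ℂ) (hherm : ∀ p, (ι p).IsHermitian)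
    (hnorm : ∀ p, ‖p‖ ≤ ‖ι p‖) (hsurj : ∀ B : Matrix (Fin N) (Fin N) ℂ, B.IsHermitian → ∃ p, ι p = B)
    (hN : 1 ≤ N) (T : ℝ) (hT : 0 < T) (V₁ V₂ : Polynomial ℝ)
    (hconf : ∃ c > (0 : ℝ), ∃ C : ℝ, ∀ x y : ℝ,
      c * (x ^ 2 + y ^ 2) - C ≤ V₁.eval x + V₂.eval y - x * y)
    (x y : ℂ) (hx : x.im ≠ 0) :
    (∫ p : H × H, hweight N T V₁ V₂ (ι p.1) (ι p.2) ∂(μ.prod μ)) ≠ 0 ∧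
    ∫ p : H × H, ((x • (1 : Matrix (Fin N) (Fin N) ℂ) - (ι p.1))⁻¹ *
      SVmat V₂ y (ι p.2)).trace *
      ((x • (1 : Matrix (Fin N) (Fin N) ℂ) - (ι p.1))⁻¹).trace * hweight N T V₁ V₂ (ι p.1) (ι p.2)
        ∂(μ.prod μ) =
    (N : ℂ) / (T : ℂ) * ((aeval x (derivative V₁) - y) *
      ∫ p : H × H, ((x • (1 : Matrix (Fin N) (Fin N) ℂ) - (ι p.1))⁻¹ *
        SVmat V₂ y (ι p.2)).trace * hweight N T V₁ V₂ (ι p.1) (ι p.2) ∂(μ.prod μ)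
      - ∫ p : H × H, (SVmat V₁ x (ι p.1) * SVmat V₂ y (ι p.2)).trace *
        hweight N T V₁ V₂ (ι p.1) (ι p.2) ∂(μ.prod μ)
      + (aeval y (derivative V₂) - x) *
        ∫ p : H × H, ((x • (1 : Matrix (Fin N) (Fin N) ℂ) - (ι p.1))⁻¹).trace *
          hweight N T V₁ V₂ (ι p.1) (ι p.2) ∂(μ.prod μ)
      + N * ∫ p : H × H, hweight N T V₁ V₂ (ι p.1) (ι p.2) ∂(μ.prod μ)) := by
  haveI : ProperSpace H := FiniteDimensional.proper_real _
  have d : LoopData N T V₁ V₂ (ι.comp (ContinuousLinearMap.fst ℝ H H))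
      (ι.comp (ContinuousLinearMap.snd ℝ H H)) :=
    { hN := hN
      hT := hT
      hconf := hconf
      h₁ := fun p => hherm p.1
      h₂ := fun p => hherm p.2
      norm_le := fun p => by
        change max ‖p.1‖ ‖p.2‖ ≤ ‖ι p.1‖ + ‖ι p.2‖
        exact (max_le_add_of_nonneg (norm_nonneg _) (norm_nonneg _)).trans
          (add_le_add (hnorm _) (hnorm _))
      surj := fun B C hB hC => by
        obtain ⟨b, rfl⟩ := hsurj B hB
        obtain ⟨c, rfl⟩ := hsurj C hC
        exact ⟨(b, c), rfl, rfl⟩ }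
  exact ⟨d.Z_ne (μ.prod μ), d.core (μ.prod μ) x y hx⟩


lemma loop_final (N : ℕ) (hN : 1 ≤ N) (T : ℝ) (hT : 0 < T) (V₁ V₂ : Polynomial ℝ)
    (hconf : ∃ c > (0 : ℝ), ∃ C : ℝ, ∀ x y : ℝ,
      c * (x ^ 2 + y ^ 2) - C ≤ V₁.eval x + V₂.eval y - x * y)
    [MeasurableSpace (HermMat N)] [hB : BorelSpace (HermMat N)]
    (μ : Measure (HermMat N)) [hμ : μ.IsAddHaarMeasure] (x y : ℂ) (hx : x.im ≠ 0) :
    (∫ p : HermMat N × HermMat N, hweight N T V₁ V₂ p.1.1 p.2.1 ∂(μ.prod μ)) ≠ 0 ∧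
    ∫ p : HermMat N × HermMat N, ((x • (1 : Matrix (Fin N) (Fin N) ℂ) - p.1.1)⁻¹ *
      SVmat V₂ y p.2.1).trace *
      ((x • (1 : Matrix (Fin N) (Fin N) ℂ) - p.1.1)⁻¹).trace * hweight N T V₁ V₂ p.1.1 p.2.1
        ∂(μ.prod μ) =
    (N : ℂ) / (T : ℂ) * ((aeval x (derivative V₁) - y) *
      ∫ p : HermMat N × HermMat N, ((x • (1 : Matrix (Fin N) (Fin N) ℂ) - p.1.1)⁻¹ *
        SVmat V₂ y p.2.1).trace * hweight N T V₁ V₂ p.1.1 p.2.1 ∂(μ.prod μ)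
      - ∫ p : HermMat N × HermMat N, (SVmat V₁ x p.1.1 * SVmat V₂ y p.2.1).trace *
        hweight N T V₁ V₂ p.1.1 p.2.1 ∂(μ.prod μ)
      + (aeval y (derivative V₂) - x) *
        ∫ p : HermMat N × HermMat N, ((x • (1 : Matrix (Fin N) (Fin N) ℂ) - p.1.1)⁻¹).trace *
          hweight N T V₁ V₂ p.1.1 p.2.1 ∂(μ.prod μ)
      + N * ∫ p : HermMat N × HermMat N, hweight N T V₁ V₂ p.1.1 p.2.1 ∂(μ.prod μ)) := by
  let ι : HermMat N →ₗ[ℝ] Matrix (Fin N) (Fin N) ℂ :=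
    { toFun := fun p => p.1, map_add' := fun _ _ => rfl, map_smul' := fun _ _ => rfl }
  haveI i3 : FiniteDimensional ℝ (HermMat N) :=
    FiniteDimensional.of_injective ι Subtype.val_injective
  let ι' : HermMat N →L[ℝ] Matrix (Fin N) (Fin N) ℂ := ⟨ι, continuous_subtype_val⟩
  exact @loop_prod N (HermMat N) inferInstance inferInstance i3 _ hB μ hμ ι' (fun p => p.2)
    (fun p => le_refl _) (fun B hB => ⟨⟨B, hB⟩, rfl⟩) hN T hT V₁ V₂ hconf x y hx

end loop

theorem master_loop_equation
    (N : ℕ) (hN : 1 ≤ N) (T : ℝ) (hT : 0 < T) (V₁ V₂ : Polynomial ℝ)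
    (hconf : ∃ c > (0 : ℝ), ∃ C : ℝ, ∀ x y : ℝ,
      c * (x ^ 2 + y ^ 2) - C ≤ V₁.eval x + V₂.eval y - x * y)
    [MeasurableSpace (HermMat N)] [BorelSpace (HermMat N)]
    (μ : Measure (HermMat N)) [μ.IsAddHaarMeasure] :
    ∀ x : ℂ, x.im ≠ 0 →
      Efun N T V₁ V₂ μ x (Yfun N T V₁ V₂ μ x)
        = ((T : ℂ) ^ 2 / (N : ℂ) ^ 2) * Uconn N T V₁ V₂ μ x (Yfun N T V₁ V₂ μ x) x := by
  intro x hx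
  have hy : Yfun N T V₁ V₂ μ x =
    Polynomial.aeval x V₁.derivative - (T : ℂ) * resolvent1 N T V₁ V₂ μ x := rfl
  generalize Yfun N T V₁ V₂ μ x = y at hy ⊢
  obtain ⟨hZ, h⟩ := loop_final N hN T hT V₁ V₂ hconf μ x y hx
  have hN' : (N : ℂ) ≠ 0 := by exact_mod_cast (by omega : N ≠ 0)
  have hT' : (T : ℂ) ≠ 0 := by exact_mod_cast hT.ne'
  have ha : Polynomial.aeval x V₁.derivative = y + (T : ℂ) * resolvent1 N T V₁ V₂ μ x := by
    rw [hy]; ring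
  unfold Efun Uconn
  rw [ha] at h ⊢
  unfold Pfun Ufun resolvent1 expectation at *
  rw [h]
  generalize (∫ p : HermMat N × HermMat N, hweight N T V₁ V₂ p.1.1 p.2.1 ∂(μ.prod μ)) = Z at *
  field_simp
  ring
end
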